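/- arXiv:1608.04675 — 3 statements merged into one kernel-verified Lean document; each statement's English description precedes it below -/
import Mathlib

section
/- For n, r, s, t ∈ ℕ with r, s ≥ 2 and n ≥ 4s^{r-1}·t·r + t, there exists an (r+1)-saturated graph G on n vertices with e(G) ≥ t_r(n) − ((r-1)/r)·t·n − 4(r-1)·t·s^r such that every complete r-partite induced subgraph of G has at most n − 2t·s^{r-1} vertices. -/
open SimpleGraph Finset
open scoped Classical

/-- `t_r(n)`: the number of edges of the `r`-partite Turán graph on `n` vertices. -/
noncomputable def turanEdges (r n : ℕ) : ℕ := (SimpleGraph.turanGraph n r).edgeFinset.card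

/-- A graph is `k`-saturated (maximal `K_k`-free) if it is `K_k`-free but adding any edge of
the complement creates a `K_k`. -/
def Saturated {V : Type} (k : ℕ) (G : SimpleGraph V) : Prop :=
  G.CliqueFree k ∧
    ∀ v w : V, v ≠ w → ¬ G.Adj v w →
      ¬ (G ⊔ SimpleGraph.fromEdgeSet {s(v, w)}).CliqueFree k

/-- `S` induces a complete `r`-partite subgraph of `G`: `S` can be partitioned into (at most)
`r` classes such that two vertices of `S` are adjacent in `G` iff they lie in different
classes. -/
def IsCompleteMultipartiteOn {V : Type} [DecidableEq V] (G : SimpleGraph V) (r : ℕ)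
    (S : Finset V) : Prop :=
  ∃ P : Fin r → Finset V, (∀ i j : Fin r, i ≠ j → Disjoint (P i) (P j)) ∧
    S = Finset.univ.biUnion P ∧
    ∀ v ∈ S, ∀ w ∈ S, (G.Adj v w ↔ ¬ ∃ i : Fin r, v ∈ P i ∧ w ∈ P i)

/-- Any `k`-clique-free graph on a finite vertex set extends to a `k`-saturated one. -/
theorem exists_saturated_ge {V : Type} [Finite V] {k : ℕ} {H : SimpleGraph V}
    (hH : H.CliqueFree k) : ∃ G : SimpleGraph V, H ≤ G ∧ Saturated k G := by
  obtain ⟨G, hHG, hG⟩ :=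
    (Set.toFinite {G : SimpleGraph V | G.CliqueFree k}).exists_le_maximal hH
  refine ⟨G, hHG, hG.prop, fun v w hvw hadj hfree => hadj ?_⟩
  refine hG.le_of_ge (y := G ⊔ fromEdgeSet {s(v, w)}) hfree le_sup_left ?_
  simp [hvw]

theorem not_cliqueFree_of_forall_lt_adj {V : Type} {k : ℕ} {G : SimpleGraph V} (g : Fin k → V)
    (hg : ∀ i j, i < j → G.Adj (g i) (g j)) : ¬ G.CliqueFree k := by
  have hne : ∀ i j, i ≠ j → G.Adj (g i) (g j) := fun i j hij =>
    (lt_or_gt_of_ne hij).elim (hg i j) fun h => (hg j i h).symm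
  have hinj : Function.Injective g := fun i j h => by
    by_contra hij
    exact (hne i j hij).ne h
  exact IsContained.not_cliqueFree ⟨⟨⟨g, fun {i j} hij => hne i j hij⟩, hinj⟩⟩

theorem mod_pow_eq_of_digits_eq {s : ℕ} (m : ℕ) {a b : ℕ}
    (h : ∀ j < m, a / s ^ j % s = b / s ^ j % s) : a % s ^ m = b % s ^ m := by
  induction m with
  | zero => simp [Nat.mod_one]
  | succ m ih =>
    rw [Nat.mod_pow_succ, Nat.mod_pow_succ, ih fun j hj => h j (by omega), h m (by omega)]

/-- Index of the gadget of a vertex `v`, where `v % r` is the part containing `v`. Each gadget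
has `2 * s ^ (r - 1)` vertices in parts `0` and `1`, and `s` vertices in every other part. -/
def gadget (r s v : ℕ) : ℕ :=
  if v % r ≤ 1 then v / r / (2 * s ^ (r - 1)) else v / r / s

/-- The `j`-th letter of the word labelling `v`. A vertex outside parts `0` and `1` carries a
single letter. -/
def letter (r s v j : ℕ) : ℕ :=
  if v % r ≤ 1 then v / r / s ^ (j - 2) % s else v / r % s

/-- The non-adjacent pairs (ordered by part) inside a gadget. -/
def Conflict (r s u v : ℕ) : Prop :=
  (u % r = 0 ∧ v % r = 1 ∧ ∀ j, 2 ≤ j → j < r → letter r s u j = letter r s v j) ∨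
    (u % r ≤ 1 ∧ 2 ≤ v % r ∧ letter r s u (v % r) ≠ letter r s v (v % r))

/-- Adjacency in the construction, ordered by part. The vertices `v ≥ N` are apexes: the apex
`N + i` is joined to the `i`-th gadget. -/
def GadgetRel (r s t N u v : ℕ) : Prop :=
  (u < N ∧ v < N ∧ u % r < v % r ∧
      (gadget r s u = gadget r s v → gadget r s u < t → ¬ Conflict r s u v)) ∨
    (u < N ∧ N ≤ v ∧ gadget r s u = v - N)

/-- A Turán graph on the first `n - t` vertices with `t` gadgets carved out, and an apex for each
of them. -/
def gadgetGraph (r s t n : ℕ) : SimpleGraph (Fin n) :=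
  SimpleGraph.fromRel fun u v => GadgetRel r s t (n - t) u v

theorem GadgetRel.adj {r s t n : ℕ} {u v : Fin n} (h : GadgetRel r s t (n - t) u v) :
    (gadgetGraph r s t n).Adj u v := by
  rw [gadgetGraph, fromRel_adj]
  refine ⟨?_, Or.inl h⟩
  rintro rfl
  rcases h with h | h <;> omega

/-- The part of a vertex, where the apexes form part `r`. -/
def gadgetColor (r N v : ℕ) : ℕ := if v < N then v % r else r

theorem GadgetRel.color_lt {r s t N u v : ℕ} (hr : 0 < r) (h : GadgetRel r s t N u v) :
    gadgetColor r N u < gadgetColor r N v := by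
  have := Nat.mod_lt u hr
  unfold gadgetColor
  rcases h with ⟨h1, h2, h3, -⟩ | ⟨h1, h2, -⟩
  · simpa [h1, h2] using h3
  · simpa [h1, h2.not_gt] using this

theorem gadgetRel_of_adj {r s t n : ℕ} (hr : 0 < r) {u v : Fin n}
    (h : (gadgetGraph r s t n).Adj u v)
    (hc : gadgetColor r (n - t) u < gadgetColor r (n - t) v) :
    GadgetRel r s t (n - t) u v := by
  rw [gadgetGraph, fromRel_adj] at h
  exact h.2.resolve_right fun h' => (h'.color_lt hr).not_gt hc

theorem gadgetGraph_cliqueFree {r s t n : ℕ} (hr : 2 ≤ r) :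
    (gadgetGraph r s t n).CliqueFree (r + 1) := by
  intro S hS
  have hr0 : 0 < r := by omega
  set c : Fin n → ℕ := fun v => gadgetColor r (n - t) v with hc
  have hcle : ∀ v, c v ≤ r := fun v => by
    simp only [hc, gadgetColor]
    split_ifs
    · exact (Nat.mod_lt _ hr0).le
    · exact le_rfl
  have hinj : Set.InjOn c S := by
    intro u hu v hv huv
    by_contra hne
    have hadj := hS.1 hu hv hne
    rw [gadgetGraph, fromRel_adj] at hadj
    rcases hadj.2 with h | h
    · exact (h.color_lt hr0).ne huv
    · exact (h.color_lt hr0).ne huv.symm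
  have himg : S.image c = range (r + 1) := by
    refine eq_of_subset_of_card_le ?_ ?_
    · intro x hx
      obtain ⟨v, -, rfl⟩ := mem_image.1 hx
      exact mem_range.2 (Nat.lt_succ_of_le (hcle v))
    · rw [card_image_of_injOn hinj, hS.2, card_range]
  have hex : ∀ p, p ≤ r → ∃ v ∈ S, c v = p := fun p hp =>
    mem_image.1 (himg ▸ mem_range.2 (Nat.lt_succ_of_le hp))
  have : Nonempty (Fin n) := ⟨(hex 0 (Nat.zero_le r)).choose⟩
  choose! g hgS hgc using hex
  have hrel : ∀ p q, p < q → q ≤ r → GadgetRel r s t (n - t) (g p) (g q) := by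
    intro p q hpq hq
    have hlt : c (g p) < c (g q) := by rwa [hgc p (by omega), hgc q hq]
    refine gadgetRel_of_adj hr0 (hS.1 (hgS p (by omega)) (hgS q hq) ?_) hlt
    intro h
    rw [h] at hlt
    exact hlt.ne rfl
  have hNle : n - t ≤ (g r : ℕ) := by
    by_contra h
    have h1 := hgc r le_rfl
    simp only [hc, gadgetColor, if_pos (not_le.1 h)] at h1
    exact (Nat.mod_lt _ hr0).ne h1
  have hapex : ∀ p < r, (g p : ℕ) < n - t ∧ gadget r s (g p) = g r - (n - t) := by
    intro p hp
    rcases hrel p r hp le_rfl with h | h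
    · omega
    · exact ⟨h.1, h.2.2⟩
  have hmod : ∀ p < r, (g p : ℕ) % r = p := by
    intro p hp
    have h1 := hgc p hp.le
    simpa only [hc, gadgetColor, if_pos (hapex p hp).1] using h1
  have hlt : (g r : ℕ) - (n - t) < t := by
    have := (g r).isLt
    omega
  have hconf : ∀ p q, p < q → q < r → ¬ Conflict r s (g p) (g q) := by
    intro p q hpq hq
    rcases hrel p q hpq hq.le with h | h
    · refine h.2.2.2 ?_ ?_
      · rw [(hapex p (hpq.trans hq)).2, (hapex q hq).2]
      · rwa [(hapex p (hpq.trans hq)).2]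
    · have := (hapex q hq).1
      omega
  have hletter : ∀ p ≤ 1, ∀ j, 2 ≤ j → j < r → letter r s (g p) j = letter r s (g j) j := by
    intro p hp j hj hjr
    by_contra hne
    refine hconf p j (by omega) hjr (Or.inr ⟨?_, ?_, ?_⟩)
    · rw [hmod p (by omega)]; exact hp
    · rw [hmod j hjr]; exact hj
    · rwa [hmod j hjr]
  refine hconf 0 1 (by omega) (by omega) (Or.inl ⟨hmod 0 (by omega), hmod 1 (by omega), ?_⟩)
  intro j hj hjr
  rw [hletter 0 (by omega) j hj hjr, hletter 1 le_rfl j hj hjr]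

section Vertex

variable {r q p : ℕ}

theorem vertex_mod (hp : p < r) : (q * r + p) % r = p := by
  rw [mul_comm, Nat.mul_add_mod, Nat.mod_eq_of_lt hp]

theorem vertex_div (hp : p < r) : (q * r + p) / r = q := by
  rw [mul_comm, Nat.mul_add_div (by omega), Nat.div_eq_of_lt hp, add_zero]

theorem vertex_lt {m : ℕ} (hp : p < r) (hq : q < m) : q * r + p < m * r := by
  calc q * r + p < (q + 1) * r := by rw [add_mul]; omega
    _ ≤ m * r := Nat.mul_le_mul_right r hq

theorem gadget_vertex_le_one {s : ℕ} (hp : p < r) (hp1 : p ≤ 1) :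
    gadget r s (q * r + p) = q / (2 * s ^ (r - 1)) := by
  rw [gadget, vertex_mod hp, vertex_div hp, if_pos hp1]

theorem gadget_vertex_two_le {s : ℕ} (hp : p < r) (hp2 : 2 ≤ p) :
    gadget r s (q * r + p) = q / s := by
  rw [gadget, vertex_mod hp, vertex_div hp, if_neg (by omega)]

theorem letter_vertex_le_one {s j : ℕ} (hp : p < r) (hp1 : p ≤ 1) :
    letter r s (q * r + p) j = q / s ^ (j - 2) % s := by
  rw [letter, vertex_mod hp, vertex_div hp, if_pos hp1]

theorem letter_vertex_two_le {s j : ℕ} (hp : p < r) (hp2 : 2 ≤ p) :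
    letter r s (q * r + p) j = q % s := by
  rw [letter, vertex_mod hp, vertex_div hp, if_neg (by omega)]

end Vertex

/-- Matching vertices of parts `0` and `1` are non-adjacent in any clique-free extension. -/
theorem not_adj_matching {r s t n q : ℕ} (hr : 2 ≤ r) (hs : 0 < s)
    (hn : 4 * s ^ (r - 1) * t * r + t ≤ n) (hq : q < 2 * t * s ^ (r - 1))
    {G : SimpleGraph (Fin n)} (hle : gadgetGraph r s t n ≤ G) (hG : G.CliqueFree (r + 1))
    {b c : Fin n} (hb : (b : ℕ) = q * r + 0) (hc : (c : ℕ) = q * r + 1) : ¬ G.Adj b c := by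
  intro hbc
  set K := 2 * s ^ (r - 1) with hK
  have hKs : s ≤ K := by
    calc s = s ^ 1 := (pow_one s).symm
      _ ≤ s ^ (r - 1) := Nat.pow_le_pow_right hs (by omega)
      _ ≤ K := by omega
  have hN : 2 * (K * t) * r ≤ n - t := by
    have : 2 * (K * t) * r = 4 * s ^ (r - 1) * t * r := by rw [hK]; ring
    omega
  have hτ : q / K < t := by
    rw [Nat.div_lt_iff_lt_mul (by omega)]
    calc q < 2 * t * s ^ (r - 1) := hq
      _ = t * K := by rw [hK]; ring
  set d : ℕ → ℕ := fun p => q / s ^ (p - 2) % s with hd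
  have hds : ∀ p, d p < s := fun p => Nat.mod_lt _ hs
  have hsmall : ∀ p, q / K * s + d p < 2 * (K * t) := by
    intro p
    have h1 : (q / K + 1) * s ≤ t * K := Nat.mul_le_mul hτ hKs
    have h2 := hds p
    rw [add_mul, mul_comm t] at h1
    omega
  have hq2 : q < 2 * (K * t) := by
    have : 2 * t * s ^ (r - 1) = K * t := by rw [hK]; ring
    omega
  set f : ℕ → ℕ := fun p =>
    if p ≤ 1 then q * r + p else if p < r then (q / K * s + d p) * r + p else n - t + q / K with hf
  have hf1 : ∀ p ≤ 1, f p = q * r + p := fun p hp => if_pos hp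
  have hf2 : ∀ p, 2 ≤ p → p < r → f p = (q / K * s + d p) * r + p := fun p hp hpr => by
    simp only [hf]
    rw [if_neg (by omega), if_pos hpr]
  have hfr : f r = n - t + q / K := by
    simp only [hf]
    rw [if_neg (by omega), if_neg (by omega)]
  have hfN : ∀ p < r, f p < n - t := by
    intro p hp
    refine lt_of_lt_of_le ?_ hN
    rcases Nat.lt_or_ge p 2 with h | h
    · rw [hf1 p (by omega)]
      exact vertex_lt hp hq2
    · rw [hf2 p h hp]
      exact vertex_lt hp (hsmall p)
  have hfmod : ∀ p < r, f p % r = p := by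
    intro p hp
    rcases Nat.lt_or_ge p 2 with h | h
    · rw [hf1 p (by omega), vertex_mod hp]
    · rw [hf2 p h hp, vertex_mod hp]
  have hgad : ∀ p < r, gadget r s (f p) = q / K := by
    intro p hp
    rcases Nat.lt_or_ge p 2 with h | h
    · rw [hf1 p (by omega), gadget_vertex_le_one hp (by omega)]
    · rw [hf2 p h hp, gadget_vertex_two_le hp h, mul_comm, Nat.mul_add_div hs,
        Nat.div_eq_of_lt (hds p), add_zero]
  have hlet : ∀ p ≤ 1, ∀ j, 2 ≤ j → j < r → letter r s (f p) j = letter r s (f j) j := by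
    intro p hp j hj hjr
    rw [hf1 p hp, hf2 j hj hjr, letter_vertex_le_one (by omega) hp, letter_vertex_two_le hjr hj,
      mul_comm, Nat.mul_add_mod, Nat.mod_eq_of_lt (hds j)]
  have hfn : ∀ p ≤ r, f p < n := by
    intro p hp
    rcases hp.lt_or_eq with h | rfl
    · have := hfN p h
      omega
    · rw [hfr]
      omega
  refine not_cliqueFree_of_forall_lt_adj (k := r + 1)
    (fun p => (⟨f p, hfn p (by omega)⟩ : Fin n)) ?_ hG
  intro i j hij
  have hij' : (i : ℕ) < j := hij
  rcases (Nat.le_of_lt_succ j.isLt).lt_or_eq with hj | hj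
  · by_cases h1 : (j : ℕ) = 1
    · have h0 : (i : ℕ) = 0 := by omega
      convert hbc using 1
      · apply Fin.ext
        rw [hb]
        exact (congrArg f h0).trans (hf1 0 (by omega))
      · apply Fin.ext
        rw [hc]
        exact (congrArg f h1).trans (hf1 1 le_rfl)
    · refine hle (GadgetRel.adj (Or.inl ⟨hfN i (by omega), hfN j hj, ?_, fun _ _ => ?_⟩))
      · simpa only [hfmod i (by omega), hfmod j hj] using hij'
      · rintro (⟨-, h, -⟩ | ⟨h, h', h''⟩)
        · exact h1 ((hfmod j hj).symm.trans h)
        · simp only [hfmod i (by omega), hfmod j hj] at h h' h''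
          exact h'' (hlet i h j h' hj)
  · refine hle (GadgetRel.adj (Or.inr ⟨hfN i (by omega), ?_, ?_⟩))
    · simp only [hj, hfr]
      exact Nat.le_add_right _ _
    · simp only [hj, hfr, hgad i (by omega), Nat.add_sub_cancel_left]

/-- Two vertices of part `0` are non-adjacent in any clique-free extension. -/
theorem not_adj_part_zero {r s t n q q' : ℕ} (hr : 2 ≤ r) (hs : 0 < s) (ht : 0 < t)
    (hn : 4 * s ^ (r - 1) * t * r + t ≤ n) (hq : q < 4 * s ^ (r - 1) * t)
    (hq' : q' < 4 * s ^ (r - 1) * t)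
    {G : SimpleGraph (Fin n)} (hle : gadgetGraph r s t n ≤ G) (hG : G.CliqueFree (r + 1))
    {b v : Fin n} (hb : (b : ℕ) = q * r + 0) (hv : (v : ℕ) = q' * r + 0) : ¬ G.Adj b v := by
  intro hbv
  set M := 2 * s ^ (r - 1) * t with hM
  have hM2 : 4 * s ^ (r - 1) * t = 2 * M := by rw [hM]; ring
  have hMpos : 0 < M := by positivity
  rw [hM2] at hq hq' hn
  set f : ℕ → ℕ := fun p => if p = 0 then q * r + 0 else if p < r then M * r + p else q' * r + 0
    with hf
  have hf0 : f 0 = q * r + 0 := if_pos rfl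
  have hf1 : ∀ p, 0 < p → p < r → f p = M * r + p := fun p hp hpr => by
    simp only [hf]
    rw [if_neg (by omega), if_pos hpr]
  have hfr : f r = q' * r + 0 := by
    simp only [hf]
    rw [if_neg (by omega), if_neg (by omega)]
  have hfN : ∀ p ≤ r, f p < n - t := by
    intro p hp
    have h : f p < 2 * M * r := by
      rcases Nat.eq_zero_or_pos p with rfl | h0
      · rw [hf0]
        exact vertex_lt (by omega) hq
      · rcases hp.lt_or_eq with h | rfl
        · rw [hf1 p h0 h]
          exact vertex_lt h (by omega)
        · rw [hfr]
          exact vertex_lt (by omega) hq'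
    omega
  have hfree : ∀ p, 0 < p → p < r → t ≤ gadget r s (M * r + p) := by
    intro p hp hpr
    rcases Nat.lt_or_ge p 2 with h | h
    · rw [gadget_vertex_le_one hpr (by omega), hM, mul_comm, Nat.mul_div_cancel _ (by positivity)]
    · rw [gadget_vertex_two_le hpr h, Nat.le_div_iff_mul_le hs, hM, mul_comm]
      refine Nat.mul_le_mul_right t ?_
      calc s = s ^ 1 := (pow_one s).symm
        _ ≤ s ^ (r - 1) := Nat.pow_le_pow_right hs (by omega)
        _ ≤ 2 * s ^ (r - 1) := by omega
  have hadj : ∀ x y : Fin n, ∀ p, 0 < p → p < r → (y : ℕ) = M * r + p → (x : ℕ) < n - t →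
      (x : ℕ) % r < p → G.Adj x y := by
    intro x y p hp hpr hy hx hxp
    have hyN : (y : ℕ) < n - t := by
      rw [hy, ← hf1 p hp hpr]
      exact hfN p hpr.le
    refine hle (GadgetRel.adj (Or.inl ⟨hx, hyN, ?_, fun h h' => ?_⟩))
    · rwa [hy, vertex_mod hpr]
    · have := hfree p hp hpr
      rw [h, hy] at h'
      omega
  have hlt : ∀ p ≤ r, f p < n := fun p hp => (hfN p hp).trans_le (Nat.sub_le _ _)
  refine not_cliqueFree_of_forall_lt_adj (k := r + 1)
    (fun p => (⟨f p, hlt p (by omega)⟩ : Fin n)) ?_ hG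
  intro i j hij
  have hij' : (i : ℕ) < j := hij
  rcases (Nat.le_of_lt_succ j.isLt).lt_or_eq with hj | hj
  · refine hadj _ _ j (by omega) hj (hf1 j (by omega) hj) (hfN i (by omega)) ?_
    rcases Nat.eq_zero_or_pos (i : ℕ) with h0 | h0
    · simp only [h0, hf0, vertex_mod (show 0 < r by omega)]
      omega
    · simp only [hf1 i h0 (by omega), vertex_mod (show (i : ℕ) < r by omega)]
      omega
  · rcases Nat.eq_zero_or_pos (i : ℕ) with h0 | h0
    · convert hbv using 1
      · apply Fin.ext
        rw [hb]
        exact (congrArg f h0).trans hf0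
      · apply Fin.ext
        rw [hv]
        exact (congrArg f hj).trans hfr
    · refine (hadj _ _ i h0 (by omega) (hf1 i h0 (by omega)) (hfN j (by omega)) ?_).symm
      simp only [hj, hfr, vertex_mod (show 0 < r by omega)]
      exact h0

theorem card_le_of_isCompleteMultipartiteOn {r s t n : ℕ} (hr : 2 ≤ r) (hs : 0 < s)
    (hn : 4 * s ^ (r - 1) * t * r + t ≤ n)
    {G : SimpleGraph (Fin n)} (hle : gadgetGraph r s t n ≤ G) (hG : G.CliqueFree (r + 1))
    {S : Finset (Fin n)} (hS : IsCompleteMultipartiteOn G r S) :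
    S.card ≤ n - 2 * t * s ^ (r - 1) := by
  set M := 2 * t * s ^ (r - 1) with hM
  have hM2 : 4 * s ^ (r - 1) * t = 2 * M := by rw [hM]; ring
  have hN : 2 * M * r ≤ n - t := by
    rw [hM2] at hn
    omega
  have hlt : ∀ q p, q < 2 * M → p < r → q * r + p < n := fun q p hq hp =>
    ((vertex_lt hp hq).trans_le hN).trans_le (Nat.sub_le _ _)
  suffices h : ∃ f : ℕ → ℕ, ∀ q < M, ∃ v : Fin n, v ∉ S ∧ (v : ℕ) / r = f q ∧
      (∀ q' < M, f q = f q' → q = q') by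
    obtain ⟨f, hf⟩ := h
    rcases isEmpty_or_nonempty (Fin n) with hn0 | hn0
    · simp [S.eq_empty_of_isEmpty]
    choose! g hgS hgf hinj using hf
    have hcard : (range M).card ≤ Sᶜ.card := by
      refine card_le_card_of_injOn g (fun q hq => ?_) fun q hq q' hq' h => ?_
      · exact mem_coe.2 (mem_compl.2 (hgS q (mem_range.1 hq)))
      · refine hinj q (mem_range.1 hq) q' (mem_range.1 hq') ?_
        rw [← hgf q (mem_range.1 hq), ← hgf q' (mem_range.1 hq'), h]
    rw [card_range, card_compl, Fintype.card_fin] at hcard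
    have := card_le_univ S
    rw [Fintype.card_fin] at this
    omega
  by_cases hpair : ∃ q, ∃ hq : q < M, (⟨q * r + 0, hlt q 0 (by omega) (by omega)⟩ : Fin n) ∈ S ∧
      (⟨q * r + 1, hlt q 1 (by omega) (by omega)⟩ : Fin n) ∈ S
  · obtain ⟨q, hq, hb, hc⟩ := hpair
    have ht : 0 < t := by
      rcases Nat.eq_zero_or_pos t with rfl | h
      · simp [hM] at hq
      · exact h
    refine ⟨fun q' => M + q', fun q' hq' => ⟨⟨(M + q') * r + 0, hlt _ 0 (by omega) (by omega)⟩,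
      fun hv => ?_, vertex_div (by omega), fun q'' _ h => Nat.add_left_cancel h⟩⟩
    obtain ⟨P, hdisj, -, hP⟩ := hS
    have hnbc := not_adj_matching hr hs hn hq hle hG
      (b := ⟨q * r + 0, hlt q 0 (by omega) (by omega)⟩)
      (c := ⟨q * r + 1, hlt q 1 (by omega) (by omega)⟩) rfl rfl
    have hnbv := not_adj_part_zero hr hs ht hn (by omega) (by omega) hle hG
      (b := ⟨q * r + 0, hlt q 0 (by omega) (by omega)⟩)
      (v := ⟨(M + q') * r + 0, hlt (M + q') 0 (by omega) (by omega)⟩) (q := q) rfl rfl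
    have hvc : G.Adj ⟨(M + q') * r + 0, hlt (M + q') 0 (by omega) (by omega)⟩
        ⟨q * r + 1, hlt q 1 (by omega) (by omega)⟩ := by
      refine hle (GadgetRel.adj (Or.inl ⟨?_, ?_, ?_, fun _ h => ?_⟩))
      · exact (vertex_lt (by omega) (by omega)).trans_le hN
      · exact (vertex_lt (by omega) (by omega)).trans_le hN
      · simp only [vertex_mod (show 0 < r by omega), vertex_mod (show 1 < r by omega)]
        omega
      · rw [gadget_vertex_le_one (by omega) (by omega),
          Nat.div_lt_iff_lt_mul (by positivity)] at h
        have : t * (2 * s ^ (r - 1)) = M := by rw [hM]; ring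
        omega
    rw [hP _ hb _ hc, not_not] at hnbc
    rw [hP _ hb _ hv, not_not] at hnbv
    rw [hP _ hv _ hc] at hvc
    obtain ⟨i, hi, hi'⟩ := hnbc
    obtain ⟨j, hj, hj'⟩ := hnbv
    have hij : i = j := by
      by_contra hij
      exact disjoint_left.1 (hdisj i j hij) hi hj
    exact hvc ⟨i, hij ▸ hj', hi'⟩
  · push Not at hpair
    refine ⟨id, fun q hq => ?_⟩
    by_cases hb : (⟨q * r + 0, hlt q 0 (by omega) (by omega)⟩ : Fin n) ∈ S
    · exact ⟨_, hpair q hq hb, vertex_div (by omega), fun _ _ h => h⟩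
    · exact ⟨_, hb, vertex_div (by omega), fun _ _ h => h⟩

/-- The number of vertices below `v` outside the residue class of `v`. -/
theorem mul_card_filter_mod_ne_le {r v n : ℕ} (hr : 0 < r) (hv : v < n) :
    r * ((range v).filter fun w => w % r ≠ v % r).card ≤ (r - 1) * n := by
  have hcompl : v / r ≤ ((range v).filter fun w => w % r = v % r).card := by
    calc v / r = (range (v / r)).card := (card_range _).symm
      _ ≤ _ := by
        refine card_le_card_of_injOn (fun j => r * j + v % r) (fun j hj => ?_) fun i _ j _ h => ?_
        · have hj' : j < v / r := mem_range.1 hj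
          refine mem_coe.2 (mem_filter.2 ⟨mem_range.2 ?_, ?_⟩)
          · calc r * j + v % r < r * (v / r) + v % r := by gcongr
              _ = v := Nat.div_add_mod v r
          · simp
        · simpa [hr.ne'] using h
  have hsum := card_filter_add_card_filter_not (s := range v) fun w => w % r = v % r
  rw [card_range] at hsum
  have hdm := Nat.div_add_mod v r
  have hmod := Nat.mod_lt v hr
  obtain ⟨k, rfl⟩ : ∃ k, r = k + 1 := ⟨r - 1, by omega⟩
  simp only [Nat.add_sub_cancel]
  have h1 : k * (v + 1) ≤ k * n := Nat.mul_le_mul_left k hv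
  have h2 := Nat.mul_le_mul_left (k + 1) hcompl
  nlinarith

/-- The Turán edges meeting an apex. -/
def apexEdges (r N n : ℕ) : Finset (Sym2 ℕ) :=
  (Ico N n).biUnion fun v => ((range v).filter fun w => w % r ≠ v % r).image fun w => s(v, w)

/-- The pairs between parts `0` and `1` that lie in a common gadget and carry the same word. -/
def sameWordPairs (r s t : ℕ) : Finset (Sym2 ℕ) :=
  (range (2 * t * s ^ (r - 1)) ×ˢ range (2 * s)).image fun x =>
    s(x.1 * r + 0, (2 * s ^ (r - 1) * (x.1 / (2 * s ^ (r - 1))) +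
      (s ^ (r - 2) * x.2 + x.1 % s ^ (r - 2))) * r + 1)

/-- The pairs in a common gadget with exactly one vertex in the first two parts. -/
def letterPairs (r s t : ℕ) : Finset (Sym2 ℕ) :=
  ((Ico 2 r ×ˢ range (t * s)) ×ˢ (range 2 ×ˢ range (2 * s ^ (r - 1)))).image fun x =>
    s((2 * s ^ (r - 1) * (x.1.2 / s) + x.2.2) * r + x.2.1, x.1.2 * r + x.1.1)

theorem mul_card_apexEdges_le {r t n : ℕ} (hr : 0 < r) :
    r * (apexEdges r (n - t) n).card ≤ (r - 1) * t * n := by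
  calc r * (apexEdges r (n - t) n).card
      ≤ r * ∑ v ∈ Ico (n - t) n, ((range v).filter fun w => w % r ≠ v % r).card :=
        Nat.mul_le_mul_left r (card_biUnion_le.trans (sum_le_sum fun v _ => card_image_le))
    _ = ∑ v ∈ Ico (n - t) n, r * ((range v).filter fun w => w % r ≠ v % r).card := mul_sum ..
    _ ≤ ∑ _v ∈ Ico (n - t) n, (r - 1) * n :=
        sum_le_sum fun v hv => mul_card_filter_mod_ne_le hr (mem_Ico.1 hv).2
    _ = (n - (n - t)) * ((r - 1) * n) := by rw [sum_const, Nat.card_Ico, smul_eq_mul]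
    _ ≤ t * ((r - 1) * n) := Nat.mul_le_mul_right _ (by omega)
    _ = (r - 1) * t * n := by ring

theorem card_sameWordPairs_add_card_letterPairs_le {r s t : ℕ} (hr : 2 ≤ r) :
    (sameWordPairs r s t).card + (letterPairs r s t).card ≤ 4 * (r - 1) * t * s ^ r := by
  have h1 : (sameWordPairs r s t).card ≤ 2 * t * s ^ (r - 1) * (2 * s) :=
    card_image_le.trans (by simp)
  have h2 : (letterPairs r s t).card ≤ (r - 2) * (t * s) * (2 * (2 * s ^ (r - 1))) :=
    card_image_le.trans (by simp)
  obtain ⟨m, rfl⟩ := Nat.exists_eq_add_of_le hr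
  have e1 : 2 + m - 1 = m + 1 := by omega
  have e2 : 2 + m - 2 = m := by omega
  rw [e1] at h1 h2 ⊢
  rw [e2] at h2
  refine (add_le_add h1 h2).trans_eq ?_
  ring

theorem Conflict.mem_pairs {r s t u v : ℕ} (hr : 2 ≤ r) (hs : 0 < s)
    (hg : gadget r s u = gadget r s v) (ht : gadget r s u < t) (h : Conflict r s u v) :
    s(u, v) ∈ sameWordPairs r s t ∪ letterPairs r s t := by
  have hr0 : 0 < r := by omega
  have hu := Nat.div_add_mod u r
  have hv := Nat.div_add_mod v r
  have hK : 0 < 2 * s ^ (r - 1) := by positivity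
  rw [mem_union]
  rcases h with ⟨hu0, hv1, hlet⟩ | ⟨hu1, hv2, -⟩
  · left
    have hlet' : ∀ j < r - 2, u / r / s ^ j % s = v / r / s ^ j % s := by
      intro j hj
      have := hlet (j + 2) (by omega) (by omega)
      rwa [letter, letter, if_pos (by omega), if_pos (by omega), Nat.add_sub_cancel] at this
    have hmod := mod_pow_eq_of_digits_eq _ hlet'
    rw [gadget, gadget, if_pos (by omega), if_pos (by omega)] at hg
    rw [gadget, if_pos (by omega), Nat.div_lt_iff_lt_mul hK] at ht
    have hKm : 2 * s ^ (r - 1) = s ^ (r - 2) * (2 * s) := by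
      obtain ⟨m, rfl⟩ := Nat.exists_eq_add_of_le hr
      rw [show 2 + m - 1 = m + 1 by omega, show 2 + m - 2 = m by omega]
      ring
    refine mem_image.2 ⟨(u / r, v / r % (2 * s ^ (r - 1)) / s ^ (r - 2)), ?_, ?_⟩
    · refine mem_product.2 ⟨mem_range.2 ?_, mem_range.2 ?_⟩
      · calc u / r < t * (2 * s ^ (r - 1)) := ht
          _ = 2 * t * s ^ (r - 1) := by ring
      · rw [Nat.div_lt_iff_lt_mul (by positivity), mul_comm (2 * s), ← hKm]
        exact Nat.mod_lt _ hK
    · have e : s ^ (r - 2) * (v / r % (2 * s ^ (r - 1)) / s ^ (r - 2)) + u / r % s ^ (r - 2) =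
          v / r % (2 * s ^ (r - 1)) := by
        rw [hmod, ← Nat.mod_mod_of_dvd (v / r) (Dvd.intro _ hKm.symm), Nat.div_add_mod]
      simp only
      rw [e, hg, Nat.div_add_mod, mul_comm _ r, mul_comm _ r, ← hu0, ← hv1, hu, hv]
  · right
    rw [gadget, gadget, if_pos (by omega), if_neg (by omega)] at hg
    rw [gadget, if_pos (by omega), hg, Nat.div_lt_iff_lt_mul hs] at ht
    refine mem_image.2
      ⟨((v % r, v / r), (u % r, u / r % (2 * s ^ (r - 1)))), ?_, ?_⟩
    · simp only [mem_product, mem_Ico, mem_range]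
      exact ⟨⟨⟨hv2, Nat.mod_lt _ hr0⟩, ht⟩, by omega, Nat.mod_lt _ hK⟩
    · simp only
      rw [← hg, Nat.div_add_mod, mul_comm _ r, mul_comm _ r, hu, hv]

theorem turanEdges_le_card_edgeFinset_add {r s t n : ℕ} (hr : 2 ≤ r) (hs : 0 < s)
    {G : SimpleGraph (Fin n)} (hle : gadgetGraph r s t n ≤ G) :
    turanEdges r n ≤ G.edgeFinset.card + ((apexEdges r (n - t) n).card +
      ((sameWordPairs r s t).card + (letterPairs r s t).card)) := by
  set D := apexEdges r (n - t) n ∪ (sameWordPairs r s t ∪ letterPairs r s t) with hD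
  have hlt : ∀ u v : Fin n, (u : ℕ) % r < v % r → ¬ G.Adj u v → s((u : ℕ), (v : ℕ)) ∈ D := by
    intro u v huv hadj
    have hne : u ≠ v := by
      rintro rfl
      exact huv.ne rfl
    rw [hD, mem_union]
    by_cases hN : (u : ℕ) < n - t ∧ (v : ℕ) < n - t
    · right
      by_contra hmem
      exact hadj (hle (GadgetRel.adj (Or.inl ⟨hN.1, hN.2, huv, fun hg ht hc =>
        hmem (hc.mem_pairs hr hs hg ht)⟩)))
    · left
      rw [apexEdges, mem_biUnion]
      have hne' : (u : ℕ) ≠ v := fun h => hne (Fin.ext h)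
      rcases lt_or_gt_of_ne hne' with h | h
      · exact ⟨v, mem_Ico.2 ⟨by omega, v.isLt⟩, mem_image.2
          ⟨u, mem_filter.2 ⟨mem_range.2 h, huv.ne⟩, Sym2.eq_swap⟩⟩
      · exact ⟨u, mem_Ico.2 ⟨by omega, u.isLt⟩, mem_image.2
          ⟨v, mem_filter.2 ⟨mem_range.2 h, huv.ne'⟩, rfl⟩⟩
  have hmiss : ((turanGraph n r).edgeFinset \ G.edgeFinset).card ≤ D.card := by
    refine card_le_card_of_injOn (Sym2.map Fin.val) ?_
      (Sym2.map.injective Fin.val_injective).injOn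
    intro e
    induction e using Sym2.ind with
    | _ u v =>
      intro he
      simp only [coe_sdiff, Set.mem_sdiff, mem_coe, mem_edgeFinset, mem_edgeSet,
        turanGraph_adj] at he
      rw [Sym2.map_mk, mem_coe]
      rcases lt_or_gt_of_ne he.1 with h | h
      · exact hlt u v h he.2
      · have := hlt v u h fun h' => he.2 h'.symm
        rwa [Sym2.eq_swap] at this
  have hDcard : D.card ≤ (apexEdges r (n - t) n).card +
      ((sameWordPairs r s t).card + (letterPairs r s t).card) :=
    (card_union_le _ _).trans (by gcongr; exact card_union_le _ _)
  have := card_le_card_sdiff_add_card (s := (turanGraph n r).edgeFinset) (t := G.edgeFinset)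
  unfold turanEdges
  omega

/-- Proposition `main_construction`. For `r, s ≥ 2` and
`n ≥ 4s^{r-1}tr + t` there is an `(r+1)`-saturated graph `G` on `n` vertices with
`e(G) ≥ t_r(n) − ((r-1)/r)tn − 4(r-1)ts^r` such that every complete `r`-partite induced
subgraph of `G` has at most `n − 2ts^{r-1}` vertices. -/
theorem main_construction (r s t n : ℕ) (hr : 2 ≤ r) (hs : 2 ≤ s)
    (hn : 4 * s ^ (r - 1) * t * r + t ≤ n) :
    ∃ G : SimpleGraph (Fin n), Saturated (r + 1) G ∧
      (turanEdges r n : ℝ) - ((r : ℝ) - 1) / (r : ℝ) * t * n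
          - 4 * ((r : ℝ) - 1) * t * (s : ℝ) ^ r ≤ (G.edgeFinset.card : ℝ) ∧
      ∀ S : Finset (Fin n), IsCompleteMultipartiteOn G r S →
        S.card ≤ n - 2 * t * s ^ (r - 1) := by
  have hs0 : 0 < s := by omega
  obtain ⟨G, hle, hG⟩ := exists_saturated_ge (gadgetGraph_cliqueFree (s := s) (t := t) (n := n) hr)
  refine ⟨G, hG, ?_, fun S hS => card_le_of_isCompleteMultipartiteOn hr hs0 hn hle hG.1 hS⟩
  have hedges := turanEdges_le_card_edgeFinset_add hr hs0 hle
  have hapex := mul_card_apexEdges_le (t := t) (n := n) (show 0 < r by omega)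
  have hpairs := card_sameWordPairs_add_card_letterPairs_le (s := s) (t := t) hr
  have hr1 : ((r - 1 : ℕ) : ℝ) = (r : ℝ) - 1 := by
    rw [Nat.cast_sub (by omega), Nat.cast_one]
  have hrpos : (0 : ℝ) < r := by
    exact_mod_cast (show 0 < r by omega)
  have hapex' : ((apexEdges r (n - t) n).card : ℝ) ≤ ((r : ℝ) - 1) / r * t * n := by
    have h : (r : ℝ) * (apexEdges r (n - t) n).card ≤ ((r : ℝ) - 1) * t * n := by
      rw [← hr1]
      exact_mod_cast hapex
    rw [div_mul_eq_mul_div, div_mul_eq_mul_div, le_div_iff₀ hrpos, mul_comm]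
    exact h
  have hpairs' : ((sameWordPairs r s t).card : ℝ) + (letterPairs r s t).card ≤
      4 * ((r : ℝ) - 1) * t * (s : ℝ) ^ r := by
    rw [← hr1]
    exact_mod_cast hpairs
  have hedges' : (turanEdges r n : ℝ) ≤ G.edgeFinset.card + ((apexEdges r (n - t) n).card +
      ((sameWordPairs r s t).card + (letterPairs r s t).card)) := by
    exact_mod_cast hedges
  linarith
end

section
/- Let r ≥ 2 and ε > 0. There exist constants n₀, b₀, c₀ > 0 (depending on r and ε) such that for all n ≥ n₀ and all m with ((r-1)/r + ε)·n ≤ m ≤ b₀·n^{(r+1)/r}, there exists an (r+1)-saturated graph G on n vertices with e(G) ≥ t_r(n) − m that contains no complete r-partite induced subgraph on more than (1 − c₀·m·n^{-(r+1)/r})·n vertices. -/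
open SimpleGraph Finset
open scoped Classical

/-- Vertex types of the construction with `q + 2` parts: the parts are indexed by
`Bool ⊕ Fin q`, and the apex vertices lie outside of the parts. -/
inductive Label (k t q : ℕ) : Type
  | apex (κ : Fin k)
  | twin (s : Bool) (κ : Fin k) (z : Fin q → Fin t)
  | hub
  | sel (j : Fin q) (y : Fin t)
  | gen (p : Bool ⊕ Fin q)

namespace Label

variable {k t q : ℕ}

/-- The part of a vertex type; the value at `apex` is irrelevant. -/
def part : Label k t q → Bool ⊕ Fin q
  | apex _ => .inl false
  | twin s _ _ => .inl s
  | hub => .inl false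
  | sel j _ => .inr j
  | gen p => p

/-- Adjacency of vertex types: complete multipartite between non-apex types, except that `twin`
and `hub` see only the selectors that agree with their coordinates, and miss opposite twins with
the same coordinates (and the same apex). -/
def Rel (z₀ : Fin q → Fin t) : Label k t q → Label k t q → Prop
  | apex _, apex _ => False
  | apex κ, twin _ κ' _ => κ = κ'
  | apex _, hub => True
  | apex _, sel _ _ => True
  | apex _, gen _ => False
  | twin _ κ' _, apex κ => κ = κ'
  | twin s κ z, twin s' κ' z' => s ≠ s' ∧ (κ = κ' → z ≠ z')
  | twin s _ z, hub => s = true ∧ z ≠ z₀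
  | twin _ _ z, sel j y => z j = y
  | twin s _ _, gen p => p ≠ .inl s
  | hub, apex _ => True
  | hub, twin s _ z => s = true ∧ z ≠ z₀
  | hub, hub => False
  | hub, sel j y => z₀ j = y
  | hub, gen p => p ≠ .inl false
  | sel _ _, apex _ => True
  | sel j y, twin _ _ z => z j = y
  | sel j y, hub => z₀ j = y
  | sel j _, sel j' _ => j ≠ j'
  | sel j _, gen p => p ≠ .inr j
  | gen _, apex _ => False
  | gen p, twin s _ _ => p ≠ .inl s
  | gen p, hub => p ≠ .inl false
  | gen p, sel j _ => p ≠ .inr j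
  | gen p, gen p' => p ≠ p'

/-- The graph of vertex types. -/
def graph (z₀ : Fin q → Fin t) : SimpleGraph (Label k t q) where
  Adj := Rel z₀
  symm := ⟨by rintro (_ | _ | _ | _ | _) (_ | _ | _ | _ | _) h <;> simp_all [Rel, eq_comm]⟩
  loopless := ⟨by rintro (_ | _ | _ | _ | _) h <;> simp [Rel] at h⟩

theorem graph_adj (z₀ : Fin q → Fin t) (x y : Label k t q) :
    (graph z₀).Adj x y ↔ Rel z₀ x y := Iff.rfl

theorem part_ne_of_adj {z₀ : Fin q → Fin t} {x y : Label k t q} (h : Rel z₀ x y)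
    (hx : ∀ κ, x ≠ apex κ) (hy : ∀ κ, y ≠ apex κ) : x.part ≠ y.part := by
  rcases x with _ | _ | _ | _ | _ <;> rcases y with _ | _ | _ | _ | _ <;>
    simp_all [Rel, part] <;> simp_all [eq_comm]

theorem rel_gen_of_part_ne {z₀ : Fin q → Fin t} {x : Label k t q} {p : Bool ⊕ Fin q}
    (hx : ∀ κ, x ≠ apex κ) (hp : p ≠ x.part) : (graph z₀).Adj (gen p) x := by
  rcases x with _ | _ | _ | _ | _ <;> simp_all [graph_adj, Rel, part]

/-- No apex sees vertices of all parts that are pairwise adjacent. -/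
theorem not_transversal {z₀ : Fin q → Fin t} {κ : Fin k} (f : Bool ⊕ Fin q → Label k t q)
    (hpart : ∀ p, (f p).part = p) (hapex : ∀ p, Rel z₀ (apex κ) (f p))
    (hadj : ∀ p p', p ≠ p' → Rel z₀ (f p) (f p')) : False := by
  have hsel : ∀ j, ∃ y, f (.inr j) = sel j y := by
    intro j
    have h1 := hpart (.inr j)
    have h2 := hapex (.inr j)
    rcases h : f (.inr j) with _ | _ | _ | ⟨j', y⟩ | _ <;> simp_all [Rel, part]
  choose y hy using hsel
  have htrue : f (.inl true) = twin true κ y := by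
    have h1 := hpart (.inl true)
    have h2 := hapex (.inl true)
    have h3 := fun j => hadj (.inl true) (.inr j) (by simp)
    clear hpart hapex hadj
    rcases h : f (.inl true) with _ | ⟨s, κ', z⟩ | _ | _ | _ <;> simp_all [Rel, part]
    exact funext h3
  have h1 := hpart (.inl false)
  have h2 := hapex (.inl false)
  have h3 := fun j => hadj (.inl false) (.inr j) (by simp)
  have h4 := hadj (.inl false) (.inl true) (by simp)
  clear hpart hapex hadj
  rcases h : f (.inl false) with _ | ⟨s, κ', z⟩ | _ | _ | _ <;> simp_all [Rel, part]
  · exact h4 (funext h3)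
  · exact h4 (funext h3).symm

/-- `x` and `y` have a common neighbourhood containing a transversal clique of all parts but
one. -/
def HasCommonClique (z₀ : Fin q → Fin t) (x y : Label k t q) : Prop :=
  ∃ (p₀ : Bool ⊕ Fin q) (f : Bool ⊕ Fin q → Label k t q),
    (∀ p p', p ≠ p₀ → p' ≠ p₀ → p ≠ p' → Rel z₀ (f p) (f p')) ∧
    ∀ p, p ≠ p₀ → Rel z₀ x (f p) ∧ Rel z₀ y (f p)

theorem HasCommonClique.symm {z₀ : Fin q → Fin t} {x y : Label k t q}
    (h : HasCommonClique z₀ x y) : HasCommonClique z₀ y x :=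
  let ⟨p₀, f, hf, hxy⟩ := h
  ⟨p₀, f, hf, fun p hp => (hxy p hp).symm⟩

theorem hasCommonClique_of_part_eq (z₀ : Fin q → Fin t) {x y : Label k t q}
    (hx : ∀ κ, x ≠ apex κ) (hy : ∀ κ, y ≠ apex κ) (h : x.part = y.part) :
    HasCommonClique z₀ x y := by
  refine ⟨x.part, gen, fun p p' _ _ hpp' => hpp', fun p hp => ?_⟩
  have hgen : ∀ w : Label k t q, (∀ κ, w ≠ apex κ) → p ≠ w.part → Rel z₀ w (gen p) := by
    rintro (_ | _ | _ | _ | _) hw hp <;> simp_all [Rel, part, eq_comm]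
  exact ⟨hgen x hx hp, hgen y hy (h ▸ hp)⟩

/-- The family of types with given members in the two twin parts and the selectors of `z`
elsewhere. -/
def selFamily (A : Bool → Label k t q) (z : Fin q → Fin t) : Bool ⊕ Fin q → Label k t q
  | .inl s => A s
  | .inr j => sel j (z j)

theorem hasCommonClique_apex_apex (z₀ : Fin q → Fin t) (κ κ' : Fin k) :
    HasCommonClique z₀ (apex κ : Label k t q) (apex κ') := by
  refine ⟨.inl true, selFamily (fun _ => hub) z₀, ?_, ?_⟩
  · rintro (_ | _) (_ | _) <;> simp_all [selFamily, Rel]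
  · rintro (_ | _) <;> simp [selFamily, Rel]

theorem hasCommonClique_apex_twin (z₀ : Fin q → Fin t) {κ κ' : Fin k} (h : κ ≠ κ') (s : Bool)
    (z : Fin q → Fin t) : HasCommonClique z₀ (apex κ : Label k t q) (twin s κ' z) := by
  refine ⟨.inl s, selFamily (fun s => twin s κ z) z, ?_, ?_⟩
  · cases s <;> rintro (⟨_ | _⟩ | _) (⟨_ | _⟩ | _) <;> simp_all [selFamily, Rel]
  · rintro (_ | _) <;> simp_all [selFamily, Rel, eq_comm]

theorem exists_ne_at (ht : 2 ≤ t) (z : Fin q → Fin t) (j : Fin q) : ∃ y, z j ≠ y := by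
  have : Nontrivial (Fin t) := Fin.nontrivial_iff_two_le.mpr ht
  obtain ⟨y, hy⟩ := exists_ne (z j)
  exact ⟨y, hy.symm⟩

theorem exists_ne_eq_off (z : Fin q → Fin t) {j : Fin q} {y : Fin t} (h : z j ≠ y) :
    ∃ z', z' ≠ z ∧ z' j = y ∧ ∀ j', j' ≠ j → z' j' = z j' :=
  ⟨Function.update z j y, fun h' => h (by simpa using (congrFun h' j).symm), by simp,
    fun j' hj' => by simp [hj']⟩

theorem hasCommonClique_apex_gen (z₀ : Fin q → Fin t) (ht : 2 ≤ t) (κ : Fin k)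
    (p : Bool ⊕ Fin q) : HasCommonClique z₀ (apex κ : Label k t q) (gen p) := by
  rcases p with s | j
  · refine ⟨.inl s, selFamily (fun s => twin s κ z₀) z₀, ?_, ?_⟩
    · cases s <;> rintro (⟨_ | _⟩ | _) (⟨_ | _⟩ | _) <;> simp_all [selFamily, Rel]
    · rintro (_ | _) <;> simp_all [selFamily, Rel, eq_comm]
  · obtain ⟨y, hy⟩ := exists_ne_at ht z₀ j
    obtain ⟨z, hne, -, hz⟩ := exists_ne_eq_off z₀ hy
    refine ⟨.inr j, selFamily (fun s => twin s κ (bif s then z else z₀)) z₀, ?_, ?_⟩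
    · rintro (⟨_ | _⟩ | _) (⟨_ | _⟩ | _) <;> simp_all [selFamily, Rel, hne.symm]
    · rintro (_ | _) <;> simp_all [selFamily, Rel, eq_comm]

theorem hasCommonClique_twin_twin (z₀ : Fin q → Fin t) (κ : Fin k) (s s' : Bool)
    (z : Fin q → Fin t) : HasCommonClique z₀ (twin s κ z : Label k t q) (twin s' κ z) := by
  refine ⟨.inl true, selFamily (fun _ => apex κ) z, ?_, ?_⟩
  · rintro (_ | _) (_ | _) <;> simp_all [selFamily, Rel]
  · rintro (_ | _) <;> simp_all [selFamily, Rel]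

theorem hasCommonClique_twin_hub (z₀ : Fin q → Fin t) (κ : Fin k) (s : Bool) :
    HasCommonClique z₀ (twin s κ z₀ : Label k t q) hub := by
  refine ⟨.inl true, selFamily (fun _ => apex κ) z₀, ?_, ?_⟩
  · rintro (_ | _) (_ | _) <;> simp_all [selFamily, Rel]
  · rintro (_ | _) <;> simp_all [selFamily, Rel]

theorem hasCommonClique_twin_sel (z₀ : Fin q → Fin t) (κ : Fin k) (s : Bool)
    (z : Fin q → Fin t) {j : Fin q} {y : Fin t} (h : z j ≠ y) :
    HasCommonClique z₀ (twin s κ z : Label k t q) (sel j y) := by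
  obtain ⟨z', hne, hj, hz'⟩ := exists_ne_eq_off z h
  refine ⟨.inr j, selFamily (fun s' => if s' = s then apex κ else twin s' κ z') z, ?_, ?_⟩
  · cases s <;> rintro (⟨_ | _⟩ | _) (⟨_ | _⟩ | _) <;> simp_all [selFamily, Rel]
  · cases s <;> rintro (⟨_ | _⟩ | _) <;> simp_all [selFamily, Rel, eq_comm]

theorem hasCommonClique_hub_sel (z₀ : Fin q → Fin t) (κ : Fin k) {j : Fin q} {y : Fin t}
    (h : z₀ j ≠ y) : HasCommonClique z₀ (hub : Label k t q) (sel j y) := by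
  obtain ⟨z', hne, hj, hz'⟩ := exists_ne_eq_off z₀ h
  refine ⟨.inr j, selFamily (fun s' => bif s' then twin true κ z' else apex κ) z₀, ?_, ?_⟩
  · rintro (⟨_ | _⟩ | _) (⟨_ | _⟩ | _) <;> simp_all [selFamily, Rel]
  · rintro (⟨_ | _⟩ | _) <;> simp_all [selFamily, Rel, eq_comm]

theorem hasCommonClique_of_not_rel (z₀ : Fin q → Fin t) (ht : 2 ≤ t) (hk : 1 ≤ k)
    (x y : Label k t q) (hxy : ¬ Rel z₀ x y) : HasCommonClique z₀ x y := by
  by_cases hpart : (∀ κ, x ≠ apex κ) ∧ (∀ κ, y ≠ apex κ) ∧ x.part = y.part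
  · exact hasCommonClique_of_part_eq z₀ hpart.1 hpart.2.1 hpart.2.2
  rcases x with κ | ⟨s, κ, z⟩ | _ | ⟨j, c⟩ | p <;>
    rcases y with κ' | ⟨s', κ', z'⟩ | _ | ⟨j', c'⟩ | p' <;>
    simp [Rel, part] at hxy hpart
  · exact hasCommonClique_apex_apex z₀ κ κ'
  · exact hasCommonClique_apex_twin z₀ hxy s' z'
  · exact hasCommonClique_apex_gen z₀ ht κ p'
  · exact (hasCommonClique_apex_twin z₀ hxy s z).symm
  · obtain ⟨rfl, rfl⟩ := hxy hpart
    exact hasCommonClique_twin_twin z₀ κ s s' z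
  · obtain rfl := hxy hpart
    exact hasCommonClique_twin_hub z κ s
  · exact hasCommonClique_twin_sel z₀ κ s z hxy
  · exact absurd hxy.symm hpart
  · obtain rfl := hxy hpart
    exact (hasCommonClique_twin_hub z' κ' s').symm
  · exact hasCommonClique_hub_sel z₀ ⟨0, hk⟩ hxy
  · exact absurd hxy.symm hpart
  · exact (hasCommonClique_twin_sel z₀ κ' s' z' hxy).symm
  · exact (hasCommonClique_hub_sel z₀ ⟨0, hk⟩ hxy).symm
  · exact absurd hxy hpart
  · exact absurd hxy.symm hpart
  · exact (hasCommonClique_apex_gen z₀ ht κ' p).symm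
  all_goals exact absurd hxy hpart

end Label

/-- Blow-ups of the label graph have no `(q + 3)`-clique. -/
theorem Label.cliqueFree_comap {V : Type} {k t q : ℕ} (z₀ : Fin q → Fin t)
    (lab : V → Label k t q) : ((Label.graph z₀).comap lab).CliqueFree (q + 3) := by
  rintro s ⟨hs, hcard⟩
  have hadj : ∀ u ∈ s, ∀ v ∈ s, u ≠ v → Rel z₀ (lab u) (lab v) := fun u hu v hv huv =>
    hs hu hv huv
  have hinj : ∀ u ∈ s, ∀ v ∈ s, (∀ κ, lab u ≠ apex κ) → (∀ κ, lab v ≠ apex κ) →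
      (lab u).part = (lab v).part → u = v := by
    intro u hu v hv h1 h2 h
    by_contra huv
    exact part_ne_of_adj (hadj u hu v hv huv) h1 h2 h
  by_cases hap : ∃ u ∈ s, ∃ κ, lab u = apex κ
  · obtain ⟨u, hu, κ, hκ⟩ := hap
    have hnon : ∀ v ∈ s.erase u, ∀ κ', lab v ≠ apex κ' := by
      intro v hv κ' h
      have := hadj u hu v (mem_of_mem_erase hv) (ne_of_mem_erase hv).symm
      simp [hκ, h, Rel] at this
    have himg : (s.erase u).image (fun v => (lab v).part) = univ := by
      apply eq_univ_of_card
      rw [card_image_of_injOn, card_erase_of_mem hu, hcard]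
      · simp; omega
      · intro v hv w hw h
        exact hinj v (mem_of_mem_erase hv) w (mem_of_mem_erase hw) (hnon v hv) (hnon w hw) h
    have hex : ∀ p, ∃ v ∈ s.erase u, (lab v).part = p := fun p => by
      simpa using himg.ge (mem_univ p)
    choose g hg hgp using hex
    refine not_transversal (z₀ := z₀) (κ := κ) (fun p => lab (g p)) hgp (fun p => ?_)
      fun p p' hpp' => ?_
    · rw [← hκ]
      exact hadj u hu _ (mem_of_mem_erase (hg p)) (ne_of_mem_erase (hg p)).symm
    · refine hadj _ (mem_of_mem_erase (hg p)) _ (mem_of_mem_erase (hg p')) fun h => hpp' ?_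
      rw [← hgp p, ← hgp p', h]
  · push Not at hap
    have := card_le_card_of_injOn (t := univ) (fun v => (lab v).part) (by simp)
      fun v hv w hw h => hinj v hv w hw (hap v hv) (hap w hw) h
    simp [hcard] at this
    omega

theorem Label.saturated_comap {V : Type} {k t q : ℕ} (z₀ : Fin q → Fin t) (ht : 2 ≤ t)
    (hk : 1 ≤ k) (lab : V → Label k t q) (hlab : Function.Surjective lab) :
    Saturated (q + 3) ((Label.graph z₀).comap lab) := by
  refine ⟨cliqueFree_comap z₀ lab, fun v w hvw hnadj => ?_⟩
  obtain ⟨p₀, f, hf, hxy⟩ := hasCommonClique_of_not_rel z₀ ht hk (lab v) (lab w) hnadj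
  choose g hg using hlab
  set G := (Label.graph z₀).comap lab
  have hgadj : ∀ p p', p ≠ p₀ → p' ≠ p₀ → p ≠ p' → G.Adj (g (f p)) (g (f p')) := by
    intro p p' h h' hpp'
    change Rel z₀ _ _
    rw [hg, hg]
    exact hf p p' h h' hpp'
  have hadj : ∀ p, p ≠ p₀ → G.Adj v (g (f p)) ∧ G.Adj w (g (f p)) := by
    intro p h
    change Rel z₀ _ _ ∧ Rel z₀ _ _
    rw [hg]
    exact hxy p h
  have hclique : G.IsNClique (q + 1) ((univ.erase p₀).image fun p => g (f p)) := by
    refine ⟨?_, ?_⟩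
    · intro x hx y hy hne
      simp only [coe_image, Set.mem_image, mem_coe, mem_erase] at hx hy
      obtain ⟨p, hp, rfl⟩ := hx
      obtain ⟨p', hp', rfl⟩ := hy
      exact hgadj p p' hp.1 hp'.1 fun h => hne (by rw [h])
    · rw [card_image_of_injOn, card_erase_of_mem (mem_univ _)]
      · simp; omega
      · intro p hp p' hp' h
        by_contra hne
        exact (hgadj p p' (ne_of_mem_erase hp) (ne_of_mem_erase hp') hne).ne h
  have hclique' := (hclique.mono (le_sup_left (b := SimpleGraph.fromEdgeSet {s(v, w)})))
  refine fun hfree => hfree _ ((hclique'.insert (a := w) ?_).insert (a := v) ?_)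
  · simp only [mem_image, mem_erase]
    rintro _ ⟨p, hp, rfl⟩
    exact Or.inl (hadj p hp.1).2
  · simp only [mem_insert, mem_image, mem_erase]
    rintro _ (rfl | ⟨p, hp, rfl⟩)
    · exact Or.inr (by simpa using hvw)
    · exact Or.inl (hadj p hp.1).1

/-- The vertices of non-generic type, with the multiplicity of each type. -/
abbrev Item (k t q : ℕ) : Type :=
  Fin k ⊕ (Bool × Fin k × (Fin q → Fin t) × Fin t) ⊕ Unit ⊕ (Fin q × Fin t)

namespace Item

variable {k t q : ℕ}

abbrev apex (κ : Fin k) : Item k t q := .inl κ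

abbrev twin (s : Bool) (κ : Fin k) (z : Fin q → Fin t) (i : Fin t) : Item k t q :=
  .inr (.inl (s, κ, z, i))

abbrev hub : Item k t q := .inr (.inr (.inl ()))

abbrev sel (j : Fin q) (y : Fin t) : Item k t q := .inr (.inr (.inr (j, y)))

/-- The type of a non-generic vertex. -/
def label : Item k t q → Label k t q
  | .inl κ => .apex κ
  | .inr (.inl (s, κ, z, _)) => .twin s κ z
  | .inr (.inr (.inl _)) => .hub
  | .inr (.inr (.inr (j, y))) => .sel j y

/-- Index set for the nonadjacent pairs in different parts that avoid the apex vertices. -/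
abbrev Gap (k t q : ℕ) : Type :=
  ((Bool × Fin k × (Fin q → Fin t) × Fin t) × (Fin t ⊕ Fin q × Fin t)) ⊕
    ((Fin k × Fin t) ⊕ (Fin q × Fin t))

def gapPair (z₀ : Fin q → Fin t) : Gap k t q → Sym2 (Item k t q)
  | .inl ((s, κ, z, i), .inl i') => s(twin s κ z i, twin (!s) κ z i')
  | .inl ((s, κ, z, i), .inr (j, y)) => s(twin s κ z i, sel j y)
  | .inr (.inl (κ, i)) => s(hub, twin true κ z₀ i)
  | .inr (.inr (j, y)) => s(hub, sel j y)

theorem card_gap : Fintype.card (Gap k t q) =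
    2 * (k * (t ^ q * t)) * (t + q * t) + (k * t + q * t) := by
  simp

theorem card_item : Fintype.card (Item k t q) = k + (2 * (k * (t ^ q * t)) + (1 + q * t)) := by
  simp

theorem exists_gapPair (z₀ : Fin q → Fin t) (a b : Item k t q) (ha : ∀ κ, a ≠ apex κ)
    (hb : ∀ κ, b ≠ apex κ) (hpart : a.label.part ≠ b.label.part)
    (hrel : ¬ Label.Rel z₀ a.label b.label) : ∃ g, gapPair z₀ g = s(a, b) := by
  rcases a with κ | ⟨s, κ, z, i⟩ | _ | ⟨j, y⟩ <;>
    rcases b with κ' | ⟨s', κ', z', i'⟩ | _ | ⟨j', y'⟩ <;>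
    simp [label, Label.Rel, Label.part] at ha hb hpart hrel
  · obtain ⟨rfl, rfl⟩ := hrel hpart
    obtain rfl : s' = !s := by cases s <;> cases s' <;> simp_all
    exact ⟨.inl ((s, κ, z, i), .inl i'), rfl⟩
  · subst hpart
    obtain rfl := hrel rfl
    exact ⟨.inr (.inl (κ, i)), Sym2.eq_swap⟩
  · exact ⟨.inl ((s, κ, z, i), .inr (j', y')), rfl⟩
  · subst hpart
    obtain rfl := hrel rfl
    exact ⟨.inr (.inl (κ', i')), rfl⟩
  · exact ⟨.inr (.inr (j', y')), rfl⟩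
  · exact ⟨.inl ((s', κ', z', i'), .inr (j, y)), Sym2.eq_swap⟩
  · exact ⟨.inr (.inr (j, y)), Sym2.eq_swap⟩
  · exact absurd hrel hpart

end Item

theorem exists_embedding_mod {ι : Type} [Fintype ι] {n r : ℕ} (col : ι → Fin r) (N : ℕ)
    (hn : r * (Fintype.card ι + N) ≤ n) :
    ∃ φ : ι ↪ Fin n, (∀ a, (φ a : ℕ) % r = col a) ∧
      ∀ c : Fin r, ∃ ψ : Fin N ↪ Fin n, ∀ i, (ψ i : ℕ) % r = c ∧ ∀ a, φ a ≠ ψ i := by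
  have hlt : ∀ (x : ℕ) (c : Fin r), x < Fintype.card ι + N → r * x + c < n := by
    intro x c hx
    have := Nat.mul_le_mul_left r (Nat.succ_le_of_lt hx)
    have := c.isLt
    rw [Nat.mul_succ] at *
    omega
  have hdiv : ∀ (x : ℕ) (c : Fin r), (r * x + c) / r = x := by
    intro x c
    rw [Nat.mul_add_div (by have := c.isLt; omega), Nat.div_eq_of_lt c.isLt, add_zero]
  have hmod : ∀ (x : ℕ) (c : Fin r), (r * x + c) % r = c := by
    intro x c
    rw [Nat.mul_add_mod, Nat.mod_eq_of_lt c.isLt]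
  let idx := Fintype.equivFin ι
  refine ⟨⟨fun a => ⟨r * (idx a) + col a, hlt _ _ (by have := (idx a).isLt; omega)⟩, ?_⟩,
    fun a => hmod _ _, fun c =>
      ⟨⟨fun i => ⟨r * (Fintype.card ι + i) + c, hlt _ _ (by omega)⟩, ?_⟩, fun i => ⟨hmod _ _, ?_⟩⟩⟩
  · intro a b h
    have h' := congrArg (fun v : Fin n => (v : ℕ) / r) h
    simp only [hdiv] at h'
    exact idx.injective (Fin.ext h')
  · intro a b h
    have h' := congrArg (fun v : Fin n => (v : ℕ) / r) h
    simp only [hdiv] at h'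
    exact Fin.ext (by omega)
  · intro a h
    have h' := congrArg (fun v : Fin n => (v : ℕ) / r) h
    change (r * (idx a) + col a) / r = (r * (Fintype.card ι + i) + c) / r at h'
    rw [hdiv, hdiv] at h'
    have := (idx a).isLt
    omega

theorem exists_labelling {n k t q N : ℕ} (e : Bool ⊕ Fin q ≃ Fin (q + 2)) (ht : 1 ≤ t)
    (hN : 1 ≤ N) (hn : (q + 2) * (Fintype.card (Item k t q) + N) ≤ n) :
    ∃ (φ : Item k t q ↪ Fin n) (lab : Fin n → Label k t q),
      (∀ a, lab (φ a) = a.label) ∧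
      (∀ v, (∃ a, φ a = v) ∨ ∃ p, lab v = .gen p) ∧
      (∀ v, (e (lab v).part : ℕ) = v % (q + 2)) ∧
      Function.Surjective lab ∧
      ∃ ψ : Fin N ↪ Fin n, ∀ i, lab (ψ i) = .gen (.inl false) := by
  obtain ⟨φ, hφ, hψ⟩ := exists_embedding_mod (fun a : Item k t q => e a.label.part) N hn
  let lab : Fin n → Label k t q := fun v =>
    if h : ∃ a, φ a = v then h.choose.label
    else .gen (e.symm ⟨v % (q + 2), Nat.mod_lt _ (by omega)⟩)
  have hlab : ∀ a, lab (φ a) = a.label := by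
    intro a
    have h : ∃ b, φ b = φ a := ⟨a, rfl⟩
    simp only [lab, dif_pos h]
    rw [φ.injective h.choose_spec]
  have hgen : ∀ p, ∃ ψ : Fin N ↪ Fin n, ∀ i, lab (ψ i) = .gen p := by
    intro p
    obtain ⟨ψ, h⟩ := hψ (e p)
    refine ⟨ψ, fun i => ?_⟩
    have hno : ¬ ∃ a, φ a = ψ i := fun ⟨a, ha⟩ => (h i).2 a ha
    simp only [lab, dif_neg hno, (h i).1, Fin.eta, Equiv.symm_apply_apply]
  refine ⟨φ, lab, hlab, fun v => ?_, fun v => ?_, ?_, hgen _⟩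
  · by_cases h : ∃ a, φ a = v
    · exact .inl h
    · exact .inr ⟨_, dif_neg h⟩
  · by_cases h : ∃ a, φ a = v
    · obtain ⟨a, rfl⟩ := h
      rw [hlab, hφ]
    · simp only [lab, dif_neg h, Label.part, Equiv.apply_symm_apply]
  · rintro (κ | ⟨s, κ, z⟩ | _ | ⟨j, y⟩ | p)
    · exact ⟨_, hlab (Item.apex κ)⟩
    · exact ⟨_, hlab (Item.twin s κ z ⟨0, ht⟩)⟩
    · exact ⟨_, hlab Item.hub⟩
    · exact ⟨_, hlab (Item.sel j y)⟩
    · obtain ⟨ψ, h⟩ := hgen p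
      exact ⟨_, h ⟨0, hN⟩⟩

theorem degree_turanGraph_le {n r : ℕ} (hr : 0 < r) (v : Fin n) :
    (SimpleGraph.turanGraph n r).degree v ≤ n - n / r := by
  have hsame : n / r ≤ #{w : Fin n | (v : ℕ) % r = w % r} := by
    have hlt : ∀ i : Fin (n / r), r * i + v % r < n := by
      intro i
      have h1 := Nat.mul_le_mul_left r (Nat.succ_le_of_lt i.isLt)
      have h2 := Nat.mod_lt v hr
      have h3 := Nat.mul_div_le n r
      rw [Nat.mul_succ] at h1
      omega
    have := card_le_card_of_injOn (s := (univ : Finset (Fin (n / r))))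
      (t := ({w : Fin n | (v : ℕ) % r = w % r} : Finset (Fin n)))
      (fun i => (⟨r * i + v % r, hlt i⟩ : Fin n)) (by intro i; simp) (by
        intro i _ j _ h
        have h' := congrArg Fin.val h
        simp only [Nat.add_right_cancel_iff] at h'
        exact Fin.ext (Nat.eq_of_mul_eq_mul_left hr h'))
    simpa using this
  have hsplit := card_filter_add_card_filter_not (s := (univ : Finset (Fin n)))
    (fun w : Fin n => (v : ℕ) % r = w % r)
  have hdeg : (SimpleGraph.turanGraph n r).degree v = #{w : Fin n | ¬ (v : ℕ) % r = w % r} := by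
    rw [← SimpleGraph.card_neighborFinset_eq_degree]
    congr 1
    ext w
    simp [SimpleGraph.turanGraph_adj]
  simp only [card_univ, Fintype.card_fin] at hsplit
  omega

theorem turanEdges_le_card_edgeFinset_comap {n k t q : ℕ} (e : Bool ⊕ Fin q ≃ Fin (q + 2))
    (z₀ : Fin q → Fin t) (φ : Item k t q ↪ Fin n) (lab : Fin n → Label k t q)
    (hφ : ∀ a, lab (φ a) = a.label) (hcover : ∀ v, (∃ a, φ a = v) ∨ ∃ p, lab v = .gen p)
    (hpart : ∀ v, (e (lab v).part : ℕ) = v % (q + 2))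
    [Fintype ((Label.graph z₀).comap lab).edgeSet] :
    turanEdges (q + 2) n ≤ #((Label.graph z₀).comap lab).edgeFinset +
      (k * (n - n / (q + 2)) + Fintype.card (Item.Gap k t q)) := by
  set K := SimpleGraph.turanGraph n (q + 2)
  have hsub : K.edgeFinset ⊆ ((Label.graph z₀).comap lab).edgeFinset ∪
      ((univ.biUnion fun κ => K.incidenceFinset (φ (Item.apex κ))) ∪
        univ.image fun g => (Item.gapPair z₀ g).map φ) := by
    intro x
    induction x with | _ u v
    intro huv
    rw [SimpleGraph.mem_edgeFinset, SimpleGraph.mem_edgeSet] at huv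
    simp only [mem_union, SimpleGraph.mem_edgeFinset, SimpleGraph.mem_edgeSet, mem_biUnion,
      mem_univ, true_and, mem_image]
    have hne : (lab u).part ≠ (lab v).part := fun h => huv (by
      rw [← hpart, ← hpart, h])
    by_cases hu : ∃ κ, u = φ (Item.apex κ)
    · obtain ⟨κ, rfl⟩ := hu
      exact .inr (.inl ⟨κ, by simp [SimpleGraph.incidenceSet, huv]⟩)
    by_cases hv : ∃ κ, v = φ (Item.apex κ)
    · obtain ⟨κ, rfl⟩ := hv
      exact .inr (.inl ⟨κ, by simp [SimpleGraph.incidenceSet, huv]⟩)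
    by_cases hrel : Label.Rel z₀ (lab u) (lab v)
    · exact .inl hrel
    have hnon : ∀ w, (¬ ∃ κ, w = φ (Item.apex κ)) → ∀ κ, lab w ≠ .apex κ := by
      intro w hw κ h
      rcases hcover w with ⟨(κ' | ⟨s, κ', z, i⟩ | _ | ⟨j, y⟩), rfl⟩ | ⟨p, hp⟩
      · exact hw ⟨κ', rfl⟩
      iterate 3 · simp only [hφ, Item.label, reduceCtorEq] at h
      · simp only [hp, reduceCtorEq] at h
    rcases hcover u with ⟨a, rfl⟩ | ⟨p, hp⟩
    · rcases hcover v with ⟨b, rfl⟩ | ⟨p, hp⟩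
      · rw [hφ, hφ] at hne hrel
        obtain ⟨g, hg⟩ := Item.exists_gapPair z₀ a b (fun κ h => hu ⟨κ, by rw [h]⟩)
          (fun κ h => hv ⟨κ, by rw [h]⟩) hne hrel
        exact .inr (.inr ⟨g, by rw [hg]; rfl⟩)
      · rw [hp] at hne hrel
        exact absurd (Label.rel_gen_of_part_ne (hnon _ hu) hne.symm).symm hrel
    · rw [hp] at hne hrel
      exact absurd (Label.rel_gen_of_part_ne (hnon _ hv) hne) hrel
  have hcard := card_le_card hsub
  have h1 := card_union_le ((Label.graph z₀).comap lab).edgeFinset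
    ((univ.biUnion fun κ => K.incidenceFinset (φ (Item.apex κ))) ∪
        univ.image fun g => (Item.gapPair z₀ g).map φ)
  have h2 := card_union_le (univ.biUnion fun κ => K.incidenceFinset (φ (Item.apex κ)))
    (univ.image fun g => (Item.gapPair z₀ g).map φ)
  have h3 : #(univ.biUnion fun κ => K.incidenceFinset (φ (Item.apex κ))) ≤
      k * (n - n / (q + 2)) := by
    refine (card_biUnion_le_card_mul _ _ (n - n / (q + 2)) fun κ _ => ?_).trans (by simp)
    rw [SimpleGraph.card_incidenceFinset_eq_degree]
    convert degree_turanGraph_le (r := q + 2) (by omega) (φ (Item.apex κ))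
  have h4 : #(univ.image fun g => (Item.gapPair z₀ g).map φ) ≤ Fintype.card (Item.Gap k t q) :=
    card_image_le
  have h5 : turanEdges (q + 2) n = #K.edgeFinset := by
    unfold turanEdges
    congr!
  omega

theorem card_le_of_isCompleteMultipartiteOn_s16 {n k t q N r : ℕ} (z₀ : Fin q → Fin t)
    (φ : Item k t q ↪ Fin n) (lab : Fin n → Label k t q) (hφ : ∀ a, lab (φ a) = a.label)
    (hN : N = k * (t ^ q * t)) (ψ : Fin N ↪ Fin n) (hψ : ∀ i, lab (ψ i) = .gen (.inl false))
    (S : Finset (Fin n))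
    (hS : IsCompleteMultipartiteOn ((Label.graph z₀).comap lab) r S) : #S + N ≤ n := by
  obtain ⟨P, hdisj, rfl, hP⟩ := hS
  set S := univ.biUnion P
  suffices h : N ≤ #Sᶜ by
    have := card_add_card_compl S
    rw [Fintype.card_fin] at this
    omega
  by_cases hall : ∀ (κ : Fin k) (z : Fin q → Fin t) (i : Fin t),
      ∃ s, φ (Item.twin s κ z i) ∉ S
  · choose s hs using hall
    have := card_le_card_of_injOn (s := (univ : Finset (Fin k × (Fin q → Fin t) × Fin t)))
      (t := Sᶜ) (fun x => φ (Item.twin (s x.1 x.2.1 x.2.2) x.1 x.2.1 x.2.2))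
      (fun x _ => by simpa using hs _ _ _) (fun x _ y _ h => by
        have := φ.injective h
        simp only [Sum.inr.injEq, Sum.inl.injEq, Prod.mk.injEq] at this
        ext1
        · exact this.2.1
        · ext1
          · exact this.2.2.1
          · exact this.2.2.2)
    simpa [hN] using this
  · push Not at hall
    obtain ⟨κ, z, i, h⟩ := hall
    have := card_le_card_of_injOn (s := (univ : Finset (Fin N))) (t := Sᶜ) ψ
      (fun x _ => ?_) ψ.injective.injOn
    · simpa using this
    simp only [coe_compl, Set.mem_compl_iff, mem_coe]
    intro hx
    have hnadj1 := (hP _ (h true) _ (h false)).not_left.mp (by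
      change ¬ Label.Rel z₀ _ _
      simp [hφ, Item.label, Label.Rel])
    have hnadj2 := (hP _ (h false) _ hx).not_left.mp (by
      change ¬ Label.Rel z₀ _ _
      simp [hφ, hψ, Item.label, Label.Rel])
    have hadj := (hP _ (h true) _ hx).mp (by
      change Label.Rel z₀ _ _
      simp [hφ, hψ, Item.label, Label.Rel])
    obtain ⟨p, hp, hp'⟩ := hnadj1
    obtain ⟨p', hq, hq'⟩ := hnadj2
    obtain rfl : p = p' := by
      by_contra hne
      exact disjoint_left.mp (hdisj _ _ hne) hp' hq
    exact hadj ⟨p, hp, hq'⟩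

/-- The construction for given integer parameters. -/
theorem exists_saturated {n k t q : ℕ} (hk : 1 ≤ k) (ht : 2 ≤ t)
    (hn : (q + 2) * (q + 6) * (k * t ^ (q + 1)) ≤ n) :
    ∃ G : SimpleGraph (Fin n), Saturated (q + 3) G ∧
      turanEdges (q + 2) n ≤ #G.edgeFinset +
        (k * (n - n / (q + 2)) + 3 * (q + 2) * (k * t ^ (q + 2))) ∧
      ∀ S : Finset (Fin n), IsCompleteMultipartiteOn G (q + 2) S → #S + k * t ^ (q + 1) ≤ n := by
  have e : Bool ⊕ Fin q ≃ Fin (q + 2) := Fintype.equivOfCardEq (by simp [add_comm])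
  let z₀ : Fin q → Fin t := fun _ => ⟨0, by omega⟩
  have ht1 : t ≤ t ^ (q + 1) := Nat.le_self_pow (by omega) t
  have hpos : 1 ≤ t ^ (q + 1) := by omega
  have hkt : k * t ^ (q + 1) = k * (t ^ q * t) := by rw [pow_succ]
  have hcard : Fintype.card (Item k t q) + k * t ^ (q + 1) ≤ (q + 6) * (k * t ^ (q + 1)) := by
    rw [Item.card_item, ← hkt]
    have h1 : k ≤ k * t ^ (q + 1) := Nat.le_mul_of_pos_right _ hpos
    have h2 : t ≤ k * t ^ (q + 1) := ht1.trans (Nat.le_mul_of_pos_left _ hk)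
    have h3 := Nat.mul_le_mul_left q h2
    nlinarith
  obtain ⟨φ, lab, hφ, hcover, hpart, hsurj, ψ, hψ⟩ :=
    exists_labelling (n := n) (k := k) (t := t) (N := k * t ^ (q + 1)) e (by omega) (Nat.mul_pos hk hpos)
      ((Nat.mul_le_mul_left _ hcard).trans (by rw [← mul_assoc]; exact hn))
  refine ⟨(Label.graph z₀).comap lab, Label.saturated_comap z₀ ht hk lab hsurj, ?_,
    fun S hS => card_le_of_isCompleteMultipartiteOn_s16 z₀ φ lab hφ hkt ψ hψ S hS⟩
  refine (turanEdges_le_card_edgeFinset_comap e z₀ φ lab hφ hcover hpart).trans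
    (Nat.add_le_add_left (Nat.add_le_add_left ?_ _) _)
  rw [Item.card_gap]
  have h1 : t ≤ t ^ (q + 2) := Nat.le_self_pow (by omega) t
  have h2 : k * t ≤ k * t ^ (q + 2) := Nat.mul_le_mul_left _ h1
  have h3 : t ≤ k * t ^ (q + 2) := h1.trans (Nat.le_mul_of_pos_left _ hk)
  have h4 := Nat.mul_le_mul_left q h3
  have h5 : 2 * (k * (t ^ q * t)) * (t + q * t) = 2 * (q + 1) * (k * t ^ (q + 2)) := by ring
  rw [h5]
  nlinarith

/-- Choice of the integer parameters, with `x = n ^ (1 / r)` and `r = q + 2`. -/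
theorem exists_parameters {q n : ℕ} {ε β d m x : ℝ} (hε : 0 < ε)
    (hβ : β = (((q + 2 : ℕ) : ℝ) - 1) / ((q + 2 : ℕ) : ℝ) + ε) (hd : 0 < d) (hd1 : d ≤ 1)
    (hdε : 6 * ((q + 2 : ℕ) : ℝ) * d ≤ ε) (hn : 0 < n) (hnε : 2 ≤ ε * n) (hx : 0 < x)
    (hxn : x ^ (q + 2) = n) (hdx : 2 ≤ d * x) (hm : β * n ≤ m)
    (hm' : 2 * ((q + 2 : ℝ) * (q + 6)) * m ≤ n * x) :
    ∃ k t : ℕ, 1 ≤ k ∧ 2 ≤ t ∧ (q + 2) * (q + 6) * (k * t ^ (q + 1)) ≤ n ∧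
      ((k * (n - n / (q + 2)) + 3 * (q + 2) * (k * t ^ (q + 2)) : ℕ) : ℝ) ≤ m ∧
      (d / 2) ^ (q + 1) / (2 * β) * m / x ≤ ((k * t ^ (q + 1) : ℕ) : ℝ) := by
  have hn' : (0 : ℝ) < n := by exact_mod_cast hn
  have hR : (2 : ℝ) ≤ ((q + 2 : ℕ) : ℝ) := by push_cast; linarith [(q.cast_nonneg : (0 : ℝ) ≤ q)]
  have hβ1 : 1 / 2 ≤ β := by
    have : 1 / 2 ≤ (((q + 2 : ℕ) : ℝ) - 1) / ((q + 2 : ℕ) : ℝ) := by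
      rw [div_le_div_iff₀ (by norm_num) (by linarith)]
      linarith
    linarith
  have hβ0 : 0 < β := by linarith
  have hβn : 0 < β * n := by positivity
  have hm0 : 0 < m := hβn.trans_le hm
  have hq : 1 ≤ m / (β * n) := (one_le_div hβn).mpr hm
  set k := ⌊m / (β * n)⌋₊ with hk
  set t := ⌊d * x⌋₊ with ht
  have hk1 : 1 ≤ k := Nat.le_floor (by simpa using hq)
  have ht2 : 2 ≤ t := Nat.le_floor (by simpa using hdx)
  have hk_le : (k : ℝ) ≤ m / (β * n) := Nat.floor_le (by positivity)
  have hk_lt : m / (β * n) < k + 1 := Nat.lt_floor_add_one _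
  have ht_le : (t : ℝ) ≤ d * x := Nat.floor_le (by positivity)
  have ht_lt : d * x < t + 1 := Nat.lt_floor_add_one _
  have hk1' : (1 : ℝ) ≤ k := by exact_mod_cast hk1
  have hk_ge : m / (β * n) / 2 ≤ k := by linarith
  have ht_ge : d / 2 * x ≤ t := by linarith
  have hkβ : k * (β * n) ≤ m := (le_div_iff₀ hβn).mp hk_le
  have hxx : x ^ (q + 1) * x = n := by rw [← hxn]; ring
  refine ⟨k, t, hk1, ht2, ?_, ?_, ?_⟩
  · have htx : (t : ℝ) ^ (q + 1) ≤ x ^ (q + 1) := by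
      gcongr
      nlinarith
    have hkx : (k : ℝ) * n * ((q + 2 : ℝ) * (q + 6)) ≤ n * x := by
      have : (k : ℝ) * n ≤ 2 * m := by nlinarith [mul_nonneg (by positivity : (0 : ℝ) ≤ k) hn'.le]
      nlinarith [mul_le_mul_of_nonneg_right this
        (by positivity : (0 : ℝ) ≤ (q + 2 : ℝ) * (q + 6))]
    have hkx' : (k : ℝ) * ((q + 2 : ℝ) * (q + 6)) ≤ x := by
      refine le_of_mul_le_mul_left ?_ hn'
      linarith
    have : ((q : ℝ) + 2) * (q + 6) * (k * t ^ (q + 1)) ≤ n := by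
      calc ((q : ℝ) + 2) * (q + 6) * (k * t ^ (q + 1))
          = (k * ((q + 2 : ℝ) * (q + 6))) * t ^ (q + 1) := by ring
        _ ≤ x * x ^ (q + 1) := by gcongr
        _ = n := by rw [mul_comm, hxx]
    exact_mod_cast this
  · have hdiv : ((n - n / (q + 2) : ℕ) : ℝ) ≤
        (((q + 2 : ℕ) : ℝ) - 1) / ((q + 2 : ℕ) : ℝ) * n + 1 := by
      have h1 : (n : ℝ) < ((q + 2 : ℕ) : ℝ) * ((n / (q + 2) : ℕ) : ℝ) + ((q + 2 : ℕ) : ℝ) := by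
        exact_mod_cast Nat.lt_mul_div_succ n (by omega : 0 < q + 2)
      rw [Nat.cast_sub (Nat.div_le_self _ _)]
      generalize ((n / (q + 2) : ℕ) : ℝ) = y at h1 ⊢
      have h2 : (n : ℝ) / ((q + 2 : ℕ) : ℝ) ≤ y + 1 := by
        rw [div_le_iff₀ (by linarith)]
        linarith
      have h3 : (((q + 2 : ℕ) : ℝ) - 1) / ((q + 2 : ℕ) : ℝ) * n =
          n - n / ((q + 2 : ℕ) : ℝ) := by
        field_simp
      linarith
    have htr : 3 * ((q + 2 : ℕ) : ℝ) * (t : ℝ) ^ (q + 2) ≤ ε * n / 2 := by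
      have h1 : (t : ℝ) ^ (q + 2) ≤ d * n := by
        calc (t : ℝ) ^ (q + 2) ≤ (d * x) ^ (q + 2) := by gcongr
          _ = d ^ (q + 2) * n := by rw [mul_pow, hxn]
          _ ≤ d * n := by
            gcongr
            exact pow_le_of_le_one hd.le hd1 (by omega)
      calc 3 * ((q + 2 : ℕ) : ℝ) * (t : ℝ) ^ (q + 2)
          ≤ 3 * ((q + 2 : ℕ) : ℝ) * (d * n) := by gcongr
        _ = (6 * ((q + 2 : ℕ) : ℝ) * d) * n / 2 := by ring
        _ ≤ ε * n / 2 := by gcongr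
    calc ((k * (n - n / (q + 2)) + 3 * (q + 2) * (k * t ^ (q + 2)) : ℕ) : ℝ)
        = k * (((n - n / (q + 2) : ℕ) : ℝ) + 3 * ((q + 2 : ℕ) : ℝ) * (t : ℝ) ^ (q + 2)) := by
          rw [Nat.cast_add, Nat.cast_mul k (n - n / (q + 2))]
          push_cast
          ring
      _ ≤ k * (β * n) := by
          gcongr
          rw [hβ, add_mul]
          linarith
      _ ≤ m := hkβ
  · push_cast
    calc (d / 2) ^ (q + 1) / (2 * β) * m / x
        = m / (β * n) / 2 * (d / 2 * x) ^ (q + 1) := by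
          rw [mul_pow, ← hxx]
          field_simp
      _ ≤ k * t ^ (q + 1) := by gcongr

/-- Theorem `construction`. For `r ≥ 2` and `ε > 0` there are constants
`n₀, b₀, c₀ > 0` such that for all `n ≥ n₀` and `((r-1)/r + ε)n ≤ m ≤ b₀ n^{(r+1)/r}` there
is an `(r+1)`-saturated graph on `n` vertices with at least `t_r(n) - m` edges and no
complete `r`-partite induced subgraph on more than `(1 - c₀ m n^{-(r+1)/r})n` vertices. -/
theorem construction_theorem (r : ℕ) (hr : 2 ≤ r) (ε : ℝ) (hε : 0 < ε) :
    ∃ n₀ b₀ c₀ : ℝ, 0 < n₀ ∧ 0 < b₀ ∧ 0 < c₀ ∧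
      ∀ (n : ℕ) (m : ℝ), n₀ ≤ (n : ℝ) →
        (((r : ℝ) - 1) / (r : ℝ) + ε) * n ≤ m →
        m ≤ b₀ * (n : ℝ) ^ (((r : ℝ) + 1) / (r : ℝ)) →
        ∃ G : SimpleGraph (Fin n), Saturated (r + 1) G ∧
          (turanEdges r n : ℝ) - m ≤ (G.edgeFinset.card : ℝ) ∧
          ∀ S : Finset (Fin n), IsCompleteMultipartiteOn G r S →
            (S.card : ℝ) ≤ (1 - c₀ * m * (n : ℝ) ^ (-((r : ℝ) + 1) / (r : ℝ))) * n := by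
  obtain ⟨q, rfl⟩ := Nat.exists_eq_add_of_le' hr
  have hR : (2 : ℝ) ≤ ((q + 2 : ℕ) : ℝ) := by exact_mod_cast hr
  have hR0 : (0 : ℝ) < ((q + 2 : ℕ) : ℝ) := by linarith
  set β := (((q + 2 : ℕ) : ℝ) - 1) / ((q + 2 : ℕ) : ℝ) + ε with hβ
  have hβ0 : 0 < β := add_pos (div_pos (by linarith) hR0) hε
  obtain ⟨d, hd, hd1, hdε⟩ : ∃ d : ℝ, 0 < d ∧ d ≤ 1 ∧ 6 * ((q + 2 : ℕ) : ℝ) * d ≤ ε := by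
    refine ⟨min 1 (ε / (6 * ((q + 2 : ℕ) : ℝ))), by positivity, min_le_left _ _, ?_⟩
    rw [mul_comm, ← le_div_iff₀ (by positivity)]
    exact min_le_right _ _
  refine ⟨max ((2 / d) ^ (q + 2)) (2 / ε), 1 / (2 * ((q + 2 : ℝ) * (q + 6))),
    (d / 2) ^ (q + 1) / (2 * β), lt_max_of_lt_left (by positivity), by positivity, by positivity,
    fun n m hn hm hm' => ?_⟩
  have hn0 : (0 : ℝ) < n := lt_of_lt_of_le (lt_max_of_lt_left (by positivity)) hn
  set x : ℝ := (n : ℝ) ^ (1 / ((q + 2 : ℕ) : ℝ)) with hx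
  have hx0 : 0 < x := Real.rpow_pos_of_pos hn0 _
  have hxn : x ^ (q + 2) = n := by
    rw [hx, one_div, Real.rpow_inv_natCast_pow hn0.le (by omega)]
  have hpow : (n : ℝ) ^ ((((q + 2 : ℕ) : ℝ) + 1) / ((q + 2 : ℕ) : ℝ)) = n * x := by
    rw [add_div, div_self hR0.ne', Real.rpow_add hn0, Real.rpow_one]
  have hpow' : (n : ℝ) ^ (-(((q + 2 : ℕ) : ℝ) + 1) / ((q + 2 : ℕ) : ℝ)) = (n * x)⁻¹ := by
    rw [neg_div, Real.rpow_neg hn0.le, hpow]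
  have hdx : 2 ≤ d * x := by
    have h : (2 / d) ^ (q + 2) ≤ x ^ (q + 2) := hxn ▸ (le_max_left _ _).trans hn
    rwa [pow_le_pow_iff_left₀ (by positivity) hx0.le (by omega), div_le_iff₀ hd, mul_comm] at h
  have hnε : 2 ≤ ε * n := by
    have h := (le_max_right _ _).trans hn
    rwa [div_le_iff₀ hε, mul_comm] at h
  rw [hpow, div_mul_eq_mul_div, one_mul, le_div_iff₀ (by positivity), mul_comm] at hm'
  obtain ⟨k, t, hk, ht, hfit, hedges, hkill⟩ := exists_parameters hε hβ hd hd1 hdε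
    (by exact_mod_cast hn0) hnε hx0 hxn hdx hm hm'
  obtain ⟨G, hsat, hG, hS⟩ := exists_saturated hk ht hfit
  refine ⟨G, hsat, ?_, fun S hSG => ?_⟩
  · have h : (turanEdges (q + 2) n : ℝ) ≤ (#G.edgeFinset : ℝ) +
        ((k * (n - n / (q + 2)) + 3 * (q + 2) * (k * t ^ (q + 2)) : ℕ) : ℝ) := by
      exact_mod_cast hG
    linarith
  · have h : (#S : ℝ) + ((k * t ^ (q + 1) : ℕ) : ℝ) ≤ n := by exact_mod_cast hS S hSG
    rw [hpow']
    calc (#S : ℝ) ≤ n - (d / 2) ^ (q + 1) / (2 * β) * m / x := by linarith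
      _ = (1 - (d / 2) ^ (q + 1) / (2 * β) * m * (n * x)⁻¹) * n := by
        field_simp
end

section
/- Let r ≥ 2 and n ≥ 900r⁶ be integers. Every (r+1)-saturated graph G on n vertices with e(G) ≥ t_r(n) − m contains a complete r-partite induced subgraph on at least (1 − C_r·m·n^{-(r+1)/r})·n vertices, where C_r is a constant depending only on r. -/
open SimpleGraph Finset
open scoped Classical

/-- **Füredi's stability argument**: a `K_{r+1}`-free graph has an `r`-colouring of its vertices
with at least twice as many non-adjacent pairs of vertices of different colours as adjacent pairs
of vertices of the same colour. -/
lemma exists_coloring_two_mul_inner_le {V : Type} [DecidableEq V] (G : SimpleGraph V) (r : ℕ) :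
    ∀ U : Finset V, G.CliqueFreeOn (U : Set V) (r + 1) →
      ∃ c : V → ℕ, (∀ x ∈ U, c x < r) ∧
        2 * ∑ x ∈ U, #{y ∈ U | c x = c y ∧ G.Adj x y} ≤
          ∑ x ∈ U, #{y ∈ U | c x ≠ c y ∧ ¬ G.Adj x y} := by
  induction r with
  | zero =>
    intro U hU
    have hU' : U = ∅ := by
      by_contra hne
      obtain ⟨x, hx⟩ := Finset.nonempty_iff_ne_empty.2 hne
      exact hU (t := {x}) (by simpa using hx) (by simp [isNClique_iff])
    exact ⟨fun _ => 0, by simp [hU'], by simp [hU']⟩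
  | succ r ih =>
    intro U hU
    rcases U.eq_empty_or_nonempty with rfl | hne
    · exact ⟨fun _ => 0, by simp, by simp⟩
    obtain ⟨v, hv, hmax⟩ := U.exists_max_image (fun x => #{y ∈ U | G.Adj x y}) hne
    set N := {y ∈ U | G.Adj v y} with hN
    set A := U \ N with hA
    have hNU : N ⊆ U := filter_subset _ _
    have hfree : G.CliqueFreeOn (N : Set V) (r + 1) := by
      refine CliqueFreeOn.subset G (s₂ := (U : Set V) ∩ G.neighborSet v) ?_ (hU.of_succ G hv)
      intro y hy
      simpa [hN] using hy
    obtain ⟨c', hc'lt, hc'⟩ := ih N hfree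
    set c : V → ℕ := fun x => if x ∈ N then c' x else r with hc
    have hcN : ∀ x ∈ N, c x = c' x := fun x hx => by simp [hc, hx]
    have hcA : ∀ x ∈ A, c x = r := fun x hx => by
      simp only [hA, mem_sdiff] at hx
      simp [hc, hx.2]
    have hUd : U = N ∪ A := by rw [hA, union_sdiff_of_subset hNU]
    have hdis : Disjoint N A := disjoint_sdiff
    have split (p : V → Prop) [DecidablePred p] : #{y ∈ U | p y} = #{y ∈ N | p y} + #{y ∈ A | p y} := by
      rw [hUd, filter_union, card_union_of_disjoint (disjoint_filter_filter hdis)]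
    have hNA : ∀ x ∈ N, ∀ y ∈ A, c x ≠ c y := fun x hx y hy => by
      rw [hcN x hx, hcA y hy]
      exact (hc'lt x hx).ne
    have inner_N : ∀ x ∈ N, #{y ∈ U | c x = c y ∧ G.Adj x y} =
        #{y ∈ N | c' x = c' y ∧ G.Adj x y} := fun x hx => by
      rw [split, filter_false_of_mem (s := A) fun y hy h => hNA x hx y hy h.1, card_empty,
        add_zero]
      congr 1
      refine filter_congr fun y hy => ?_
      rw [hcN x hx, hcN y hy]
    have cross_N : ∀ x ∈ N, #{y ∈ U | c x ≠ c y ∧ ¬ G.Adj x y} =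
        #{y ∈ N | c' x ≠ c' y ∧ ¬ G.Adj x y} + #{y ∈ A | ¬ G.Adj x y} := fun x hx => by
      rw [split]
      congr 2
      · refine filter_congr fun y hy => ?_
        rw [hcN x hx, hcN y hy]
      · refine filter_congr fun y hy => ?_
        simp [hNA x hx y hy]
    have inner_A : ∀ x ∈ A, #{y ∈ U | c x = c y ∧ G.Adj x y} = #{y ∈ A | G.Adj x y} :=
      fun x hx => by
      rw [split, filter_false_of_mem (s := N) fun y hy h => hNA y hy x hx h.1.symm, card_empty,
        zero_add]
      congr 1
      refine filter_congr fun y hy => ?_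
      simp [hcA x hx, hcA y hy]
    have cross_A : ∀ x ∈ A, #{y ∈ U | c x ≠ c y ∧ ¬ G.Adj x y} = #{y ∈ N | ¬ G.Adj x y} :=
      fun x hx => by
      rw [split, filter_false_of_mem (s := A) fun y hy h => h.1 (by rw [hcA x hx, hcA y hy]),
        card_empty, add_zero]
      congr 1
      refine filter_congr fun y hy => ?_
      simp [(hNA y hy x hx).symm]
    have key : ∀ x ∈ A, #{y ∈ A | G.Adj x y} ≤ #{y ∈ N | ¬ G.Adj x y} := fun x hx => by
      have h1 := hmax x (sdiff_subset hx)
      have h2 := card_filter_add_card_filter_not (s := N) (fun y => G.Adj x y)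
      rw [split] at h1
      have h3 : #{y ∈ U | G.Adj v y} = #N := rfl
      omega
    have swap : ∑ x ∈ N, #{y ∈ A | ¬ G.Adj x y} = ∑ x ∈ A, #{y ∈ N | ¬ G.Adj x y} := by
      have := sum_card_bipartiteAbove_eq_sum_card_bipartiteBelow (s := N) (t := A)
        (fun x y => ¬ G.Adj x y)
      simpa only [bipartiteAbove, bipartiteBelow, G.adj_comm] using this
    refine ⟨c, fun x hx => ?_, ?_⟩
    · rw [hUd, mem_union] at hx
      rcases hx with hx | hx
      · rw [hcN x hx]
        exact (hc'lt x hx).trans (Nat.lt_succ_self r)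
      · rw [hcA x hx]
        exact Nat.lt_succ_self r
    · have e1 : ∑ x ∈ U, #{y ∈ U | c x = c y ∧ G.Adj x y} =
          ∑ x ∈ N, #{y ∈ N | c' x = c' y ∧ G.Adj x y} + ∑ x ∈ A, #{y ∈ A | G.Adj x y} := by
        conv_lhs => rw [show U.sum = (N ∪ A).sum by rw [← hUd]]
        rw [sum_union hdis, sum_congr rfl inner_N, sum_congr rfl inner_A]
      have e2 : ∑ x ∈ U, #{y ∈ U | c x ≠ c y ∧ ¬ G.Adj x y} =
          ∑ x ∈ N, #{y ∈ N | c' x ≠ c' y ∧ ¬ G.Adj x y} +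
            2 * ∑ x ∈ A, #{y ∈ N | ¬ G.Adj x y} := by
        conv_lhs => rw [show U.sum = (N ∪ A).sum by rw [← hUd]]
        rw [sum_union hdis, sum_congr rfl cross_N, sum_congr rfl cross_A, sum_add_distrib, swap]
        ring
      have e3 := sum_le_sum key
      rw [e1, e2]
      omega

/-- The complete multipartite graph of an `r`-colouring has at most `t_r(n)` edges. -/
lemma sum_card_ne_color_le {V : Type} [Fintype V] [DecidableEq V] {r : ℕ}
    (c : V → ℕ) (hc : ∀ x, c x < r) :
    ∑ x, #{y | c x ≠ c y} ≤ 2 * turanEdges r (Fintype.card V) := by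
  let H : SimpleGraph V := (⊤ : SimpleGraph ℕ).comap c
  have hfree : H.CliqueFree (r + 1) := by
    refine Colorable.cliqueFree (n := r) ⟨Coloring.mk (fun x => ⟨c x, hc x⟩) ?_⟩
      (Nat.lt_succ_self r)
    intro x y hxy h
    exact hxy (by simpa using h)
  have h1 := hfree.card_edgeFinset_le
  have h2 : #H.edgeFinset ≤ turanEdges r (Fintype.card V) := by
    have := card_edgeFinset_turanGraph (n := Fintype.card V) (r := r)
    unfold turanEdges
    convert! h1 using 1
  have h3 := H.sum_degrees_eq_twice_card_edges
  have h4 : ∑ x, #{y | c x ≠ c y} = ∑ x, H.degree x := by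
    refine sum_congr rfl fun x _ => ?_
    rw [← card_neighborFinset_eq_degree, neighborFinset_eq_filter]
    congr!
  omega

/-- A lower bound for the number of edges of the Turán graph. -/
lemma sq_mul_pred_le_turanEdges {r : ℕ} (hr : 0 < r) (n : ℕ) :
    (n : ℝ) ^ 2 * (r - 1) - 3 * r ^ 2 ≤ 2 * r * turanEdges r n := by
  have h1 : turanEdges r n = (n ^ 2 - (n % r) ^ 2) * (r - 1) / (2 * r) + (n % r).choose 2 := by
    rw [← card_edgeFinset_turanGraph, turanEdges]
  have hk := Nat.mod_lt n hr
  have hkn : n % r ≤ n := Nat.mod_le n r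
  have h2 := Nat.div_add_mod ((n ^ 2 - (n % r) ^ 2) * (r - 1)) (2 * r)
  have h3 := Nat.mod_lt ((n ^ 2 - (n % r) ^ 2) * (r - 1)) (show 0 < 2 * r by omega)
  generalize n % r = k at *
  rw [h1]
  generalize ((n ^ 2 - k ^ 2) * (r - 1)) / (2 * r) = a at *
  have h4 : ((n ^ 2 - k ^ 2) * (r - 1) : ℝ) ≤ 2 * r * a + 2 * r := by
    have : (n ^ 2 - k ^ 2) * (r - 1) ≤ 2 * r * a + 2 * r := by omega
    have h5 : k ^ 2 ≤ n ^ 2 := by gcongr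
    have h6 : 1 ≤ r := hr
    have := (Nat.cast_le (α := ℝ)).2 this
    push_cast [h5, h6] at this
    exact this
  push_cast [Nat.cast_choose_two]
  have hr' : (1 : ℝ) ≤ r := by exact_mod_cast hr
  have hk' : (k : ℝ) ≤ r := by exact_mod_cast hk.le
  have hk0 : (0 : ℝ) ≤ k := by positivity
  nlinarith

/-- Stability for graphs with almost as many edges as the Turán graph, phrased through
a colouring. -/
lemma exists_coloring_of_le_card_edges {V : Type} [Fintype V] [DecidableEq V]
    (G : SimpleGraph V) {r : ℕ} (hG : G.CliqueFree (r + 1)) {m : ℝ}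
    (hm : (turanEdges r (Fintype.card V) : ℝ) - m ≤ #G.edgeFinset) :
    ∃ c : V → ℕ, (∀ x, c x < r) ∧
      ((∑ x, #{y | c x ≠ c y ∧ ¬ G.Adj x y} : ℕ) : ℝ) ≤ 4 * m ∧
      2 * turanEdges r (Fintype.card V) - 2 * m ≤ ((∑ x, #{y | c x ≠ c y} : ℕ) : ℝ) := by
  obtain ⟨c, hc, h⟩ := exists_coloring_two_mul_inner_le G r univ (hG.cliqueFreeOn)
  have hc' : ∀ x, c x < r := fun x => hc x (mem_univ x)
  refine ⟨c, hc', ?_⟩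
  have h1 := sum_card_ne_color_le c hc'
  have h2 : ∑ x, #{y | c x ≠ c y} =
      ∑ x, #{y | c x ≠ c y ∧ G.Adj x y} + ∑ x, #{y | c x ≠ c y ∧ ¬ G.Adj x y} := by
    rw [← sum_add_distrib]
    refine sum_congr rfl fun x _ => ?_
    rw [← card_filter_add_card_filter_not (fun y => G.Adj x y), filter_filter, filter_filter]
  have h3 : ∑ x, G.degree x =
      ∑ x, #{y | c x = c y ∧ G.Adj x y} + ∑ x, #{y | c x ≠ c y ∧ G.Adj x y} := by
    rw [← sum_add_distrib]
    refine sum_congr rfl fun x _ => ?_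
    rw [← card_neighborFinset_eq_degree, neighborFinset_eq_filter,
      ← card_filter_add_card_filter_not (fun y => c x = c y), filter_filter, filter_filter]
    simp only [and_comm, ne_eq]
  have h4 := G.sum_degrees_eq_twice_card_edges
  generalize ∑ x, #{y | c x ≠ c y} = d at *
  generalize ∑ x, #{y | c x = c y ∧ G.Adj x y} = a at *
  generalize ∑ x, #{y | c x ≠ c y ∧ ¬ G.Adj x y} = b at *
  have hs : ((2 * #G.edgeFinset + b : ℕ) : ℝ) = (a + d : ℕ) := by
    congr 1
    omega
  rify at h h1 hs
  constructor <;> linarith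

/-- In a colouring with almost as many bichromatic pairs as the Turán graph has edges, every
colour class is large. -/
lemma div_two_mul_le_card_color {V : Type} [Fintype V] {r : ℕ} (hr : 0 < r) {c : V → ℕ}
    (hc : ∀ x, c x < r) {m : ℝ}
    (hm : 2 * turanEdges r (Fintype.card V) - 2 * m ≤ ((∑ x, #{y | c x ≠ c y} : ℕ) : ℝ))
    (hsmall : 3 * r + 2 * m ≤ (Fintype.card V / (2 * r) : ℝ) ^ 2) {i : ℕ} (hi : i < r) :
    (Fintype.card V / (2 * r) : ℝ) ≤ #{y | c y = i} := by
  have hmaps : ∀ x ∈ (univ : Finset V), c x ∈ range r := fun x _ => mem_range.2 (hc x)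
  have hsum : ∑ j ∈ range r, #{y | c y = j} = Fintype.card V :=
    (card_eq_sum_card_fiberwise hmaps).symm
  have hsq : ∑ j ∈ range r, #{y | c y = j} ^ 2 = ∑ x, #{y | c x = c y} := by
    rw [← sum_fiberwise_of_maps_to hmaps]
    refine sum_congr rfl fun j _ => ?_
    rw [sum_congr rfl (g := fun _ => #{y | c y = j}), sum_const, smul_eq_mul, sq]
    intro x hx
    rw [(mem_filter.1 hx).2]
    simp only [eq_comm]
  have hcompl : ∑ x, #{y | c x = c y} + ∑ x, #{y | c x ≠ c y} = Fintype.card V ^ 2 := by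
    rw [← sum_add_distrib, sum_congr rfl (g := fun _ => Fintype.card V)]
    · simp [sq]
    · intro x _
      rw [card_filter_add_card_filter_not, card_univ]
  have ht := sq_mul_pred_le_turanEdges hr (Fintype.card V)
  rw [← hsq] at hcompl
  generalize ∑ x, #{y | c x ≠ c y} = d at *
  have hsum' : ∑ j ∈ range r, (#{y | c y = j} : ℝ) = Fintype.card V := by exact_mod_cast hsum
  have hcompl' : ∑ j ∈ range r, (#{y | c y = j} : ℝ) ^ 2 + d = (Fintype.card V : ℝ) ^ 2 := by
    exact_mod_cast hcompl
  set n : ℝ := (Fintype.card V : ℝ)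
  have hr0 : (0 : ℝ) < r := by exact_mod_cast hr
  have hdev : ∑ j ∈ range r, ((#{y | c y = j} : ℝ) - n / r) ^ 2 =
      ∑ j ∈ range r, (#{y | c y = j} : ℝ) ^ 2 - n ^ 2 / r := by
    simp_rw [sub_sq, sum_add_distrib, sum_sub_distrib, ← sum_mul, ← mul_sum, hsum', sum_const, card_range,
      nsmul_eq_mul]
    field_simp
    ring
  have hone : ((#{y | c y = i} : ℝ) - n / r) ^ 2 ≤
      ∑ j ∈ range r, ((#{y | c y = j} : ℝ) - n / r) ^ 2 :=
    single_le_sum (f := fun j => ((#{y | c y = j} : ℝ) - n / r) ^ 2)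
      (fun _ _ => sq_nonneg _) (mem_range.2 hi)
  have ht' : n ^ 2 - n ^ 2 / r - 3 * r ≤ 2 * turanEdges r (Fintype.card V) := by
    have : n ^ 2 - n ^ 2 / r - 3 * r = (n ^ 2 * (r - 1) - 3 * r ^ 2) / r := by field_simp
    rw [this, div_le_iff₀ hr0]
    linarith
  have hle : ((#{y | c y = i} : ℝ) - n / r) ^ 2 ≤ (n / (2 * r)) ^ 2 := by linarith
  have hn : 0 ≤ n / (2 * r) := by positivity
  have := (abs_le.1 (sq_le_sq.1 hle)).1
  rw [abs_of_nonneg hn] at this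
  have h2 : n / r = 2 * (n / (2 * r)) := by field_simp
  linarith

/-- In an `r`-coloured `K_{r+1}`-free graph with large colour classes, two adjacent vertices
outside the set of vertices with many non-neighbours of a different colour have different
colours. -/
lemma color_ne_of_adj {V : Type} [Fintype V] [DecidableEq V] {G : SimpleGraph V} {r : ℕ}
    (hG : G.CliqueFree (r + 1)) {c : V → ℕ} (hc : ∀ x, c x < r) {B : Finset V} {δ : ℝ}
    (hB : ∀ x ∉ B, (#{y | c x ≠ c y ∧ ¬ G.Adj x y} : ℝ) ≤ δ)
    (hlarge : ∀ i < r, #B + r * δ < #{y | c y = i}) {x y : V} (hx : x ∉ B) (hy : y ∉ B)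
    (hxy : G.Adj x y) : c x ≠ c y := by
  intro hcol
  have hδ : 0 ≤ δ := (Nat.cast_nonneg _).trans (hB x hx)
  have key : ∀ J : Finset ℕ, J ⊆ (range r).erase (c x) →
      ∃ s : Finset V, G.IsNClique (#J + 2) s ∧ Disjoint s B ∧ ∀ z ∈ s, c z = c x ∨ c z ∈ J := by
    intro J
    induction J using Finset.induction_on with
    | empty =>
      intro _
      refine ⟨{x, y}, ?_, ?_, ?_⟩
      · simp [isNClique_iff, hxy, hxy.ne]
      · simp [hx, hy]
      · simp [hcol]
    | insert j J hj ih =>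
      intro hJ
      obtain ⟨s, hs, hsB, hsc⟩ := ih ((subset_insert j J).trans hJ)
      have hjmem := hJ (mem_insert_self j J)
      have hjr : j < r := mem_range.1 (mem_of_mem_erase hjmem)
      have hcard : #s ≤ r := by
        have h1 := card_le_card hJ
        rw [card_insert_of_notMem hj, card_erase_of_mem (mem_range.2 (hc x)), card_range] at h1
        rw [hs.card_eq]
        omega
      have hcs : ∀ z ∈ s, c z ≠ j := fun z hz h => by
        rcases hsc z hz with h' | h'
        · exact (ne_of_mem_erase hjmem) (h ▸ h')
        · exact hj (h ▸ h')
      obtain ⟨w, hw, hw'⟩ : ∃ w ∈ ({w | c w = j} : Finset V),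
          w ∉ B ∪ s.biUnion fun z => {w | c z ≠ c w ∧ ¬ G.Adj z w} := by
        by_contra! hcon
        have h1 : #{w | c w = j} ≤ #B + ∑ z ∈ s, #{w | c z ≠ c w ∧ ¬ G.Adj z w} :=
          (card_le_card hcon).trans ((card_union_le _ _).trans (by gcongr; exact card_biUnion_le))
        have h2 : ∑ z ∈ s, (#{w | c z ≠ c w ∧ ¬ G.Adj z w} : ℝ) ≤ #s * δ := by
          rw [← nsmul_eq_mul]
          exact sum_le_card_nsmul _ _ _ fun z hz => hB z (disjoint_left.1 hsB hz)
        have h3 : (#s : ℝ) * δ ≤ r * δ := by gcongr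
        have h4 := hlarge j hjr
        have h5 : (#{w | c w = j} : ℝ) ≤ #B + ∑ z ∈ s, (#{w | c z ≠ c w ∧ ¬ G.Adj z w} : ℝ) := by
          exact_mod_cast h1
        linarith
      have hwj : c w = j := (mem_filter.1 hw).2
      simp only [mem_union, mem_biUnion, mem_filter, mem_univ, true_and, not_or, not_exists,
        not_and, not_not] at hw'
      refine ⟨insert w s, ?_, ?_, ?_⟩
      · rw [card_insert_of_notMem hj, add_right_comm]
        exact hs.insert fun z hz => (hw'.2 z hz (by rw [hwj]; exact hcs z hz)).symm
      · rw [disjoint_insert_left]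
        exact ⟨hw'.1, hsB⟩
      · intro z hz
        rcases mem_insert.1 hz with rfl | hz
        · exact Or.inr (hwj ▸ mem_insert_self _ _)
        · exact (hsc z hz).imp_right (mem_insert_of_mem)
  obtain ⟨s, hs, -⟩ := key _ Subset.rfl
  have hcx := hc x
  rw [card_erase_of_mem (mem_range.2 hcx), card_range, show r - 1 + 2 = r + 1 by omega] at hs
  exact hG s hs

/-- In a saturated graph, two non-adjacent vertices have a common `(k-1)`-clique of
neighbours. -/
lemma Saturated.exists_common_clique {V : Type} [DecidableEq V] {G : SimpleGraph V} {k : ℕ}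
    (hG : Saturated (k + 2) G) {u v : V} (huv : u ≠ v) (hadj : ¬ G.Adj u v) :
    ∃ W : Finset V, G.IsNClique k W ∧ ∀ w ∈ W, G.Adj u w ∧ G.Adj v w := by
  have h := hG.2 u v huv hadj
  simp only [CliqueFree, not_forall, not_not] at h
  obtain ⟨t, ht⟩ := h
  change (G ⊔ edge u v).IsNClique (k + 2) t at ht
  have hu := hG.1.mem_of_sup_edge_isNClique ht
  have htu := ht.erase_of_sup_edge_of_mem hu
  rw [edge_comm] at ht
  have hv := hG.1.mem_of_sup_edge_isNClique ht
  have htv := ht.erase_of_sup_edge_of_mem hv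
  refine ⟨(t.erase u).erase v, ⟨?_, ?_⟩, fun w hw => ?_⟩
  · exact htu.isClique.subset (by simp)
  · rw [card_erase_of_mem (mem_erase.2 ⟨huv.symm, hv⟩), htu.card_eq]
    rfl
  · simp only [mem_erase] at hw
    exact ⟨htv.isClique (by simp [huv, hu]) (by simp [hw]) (Ne.symm hw.2.1),
      htu.isClique (by simp [huv.symm, hv]) (by simp [hw]) (Ne.symm hw.1)⟩

/-- A branching bound: if the sets `W l`, `l ∈ F`, have size `#T + j` and contain `T`, and every
`k ∈ F` has a set `Q k` of at most `q` elements which meets each `W l ∪ {l}` outside `W k`, then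
`F` has at most `(2q)^{j+1}` elements. -/
lemma card_le_of_branching {V : Type} [DecidableEq V] {W Q : V → Finset V} {q : ℕ} (j : ℕ) :
    ∀ F T : Finset V, (∀ l ∈ F, T ⊆ W l) → (∀ l ∈ F, #(W l) = #T + j) →
      (∀ k ∈ F, #(Q k) ≤ q) →
      (∀ k ∈ F, ∀ l ∈ F, ∃ x ∈ Q k, (x = l ∨ x ∈ W l) ∧ x ∉ W k) →
      #F ≤ (2 * q) ^ (j + 1) := by
  induction j with
  | zero =>
    intro F T hT hcard hq hQ
    rcases F.eq_empty_or_nonempty with rfl | ⟨k, hk⟩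
    · simp
    have hW : ∀ l ∈ F, W l = T := fun l hl =>
      (eq_of_subset_of_card_le (hT l hl) (hcard l hl).le).symm
    have : F ⊆ Q k := fun l hl => by
      obtain ⟨x, hx, h | h, hxk⟩ := hQ k hk l hl
      · exact h ▸ hx
      · rw [hW l hl, ← hW k hk] at h
        exact absurd h hxk
    have h1 := card_le_card this
    have h2 := hq k hk
    rw [zero_add, pow_one]
    omega
  | succ j ih =>
    intro F T hT hcard hq hQ
    rcases F.eq_empty_or_nonempty with rfl | ⟨k, hk⟩
    · simp
    have hcover : F ⊆ (Q k \ W k).biUnion fun x => insert x {l ∈ F | x ∈ W l} := fun l hl => by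
      obtain ⟨x, hx, h, hxk⟩ := hQ k hk l hl
      refine mem_biUnion.2 ⟨x, mem_sdiff.2 ⟨hx, hxk⟩, mem_insert.2 ?_⟩
      exact h.imp Eq.symm fun h => mem_filter.2 ⟨hl, h⟩
    have hq1 : 1 ≤ q := by
      obtain ⟨x, hx, -⟩ := hQ k hk k hk
      exact (card_pos.2 ⟨x, hx⟩).trans_le (hq k hk)
    have hbound : ∀ x ∈ Q k \ W k, #(insert x {l ∈ F | x ∈ W l}) ≤ 2 * (2 * q) ^ (j + 1) := by
      intro x hx
      have hxT : x ∉ T := fun h => (mem_sdiff.1 hx).2 (hT k hk h)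
      have hsub : ({l ∈ F | x ∈ W l} : Finset V) ⊆ F := filter_subset _ _
      have h1 := ih {l ∈ F | x ∈ W l} (insert x T)
        (fun l hl => insert_subset (mem_filter.1 hl).2 (hT l (hsub hl)))
        (fun l hl => by rw [hcard l (hsub hl), card_insert_of_notMem hxT]; ring)
        (fun l hl => hq l (hsub hl)) (fun k hk l hl => hQ k (hsub hk) l (hsub hl))
      have h2 := card_insert_le x {l ∈ F | x ∈ W l}
      have h3 : 1 ≤ (2 * q) ^ (j + 1) := Nat.one_le_pow _ _ (by omega)
      omega
    calc #F ≤ #(Q k \ W k) * (2 * (2 * q) ^ (j + 1)) :=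
          (card_le_card hcover).trans (card_biUnion_le_card_mul _ _ _ hbound)
      _ ≤ q * (2 * (2 * q) ^ (j + 1)) := by
          gcongr
          exact (card_le_card sdiff_subset).trans (hq k hk)
      _ = (2 * q) ^ (j + 1 + 1) := by ring

/-- A set on which adjacency means having different colours is complete multipartite. -/
lemma isCompleteMultipartiteOn_of_coloring {V : Type} [DecidableEq V] {G : SimpleGraph V} {r : ℕ}
    {c : V → ℕ} (hc : ∀ x, c x < r) {S : Finset V}
    (hS : ∀ v ∈ S, ∀ w ∈ S, G.Adj v w ↔ c v ≠ c w) : IsCompleteMultipartiteOn G r S := by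
  refine ⟨fun i => {v ∈ S | c v = i}, fun i j hij => ?_, ?_, fun v hv w hw => ?_⟩
  · rw [Finset.disjoint_left]
    intro v hv hv'
    exact hij (Fin.ext ((mem_filter.1 hv).2.symm.trans (mem_filter.1 hv').2))
  · ext v
    simp only [mem_biUnion, mem_univ, true_and, mem_filter]
    exact ⟨fun hv => ⟨⟨c v, hc v⟩, hv, rfl⟩, fun ⟨_, hv, _⟩ => hv⟩
  · rw [hS v hv w hw, not_iff_not]
    simp only [mem_filter, hv, hw, true_and]
    exact ⟨fun h => ⟨⟨c v, hc v⟩, rfl, h.symm⟩, fun ⟨_, h, h'⟩ => h.trans h'.symm⟩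

/-- A clique common to the neighbourhoods of two non-adjacent vertices of different colours meets
every set `B` outside which adjacent vertices have different colours. -/
lemma exists_mem_of_common_clique {V : Type} [DecidableEq V] {G : SimpleGraph V} {k : ℕ}
    {c : V → ℕ} (hc : ∀ x, c x < k + 1) {B : Finset V}
    (hB : ∀ x ∉ B, ∀ y ∉ B, G.Adj x y → c x ≠ c y) {u v : V} (hu : u ∉ B) (hv : v ∉ B)
    (huv : c u ≠ c v) {W : Finset V} (hW : G.IsNClique k W)
    (hadj : ∀ w ∈ W, G.Adj u w ∧ G.Adj v w) : ∃ b ∈ B, b ∈ W := by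
  by_contra! hcon
  have hWB : ∀ w ∈ W, w ∉ B := fun w hw hwB => hcon w hwB hw
  have huW : c u ∉ W.image c := fun h => by
    obtain ⟨w, hw, h⟩ := mem_image.1 h
    exact hB u hu w (hWB w hw) (hadj w hw).1 h.symm
  have hvW : c v ∉ W.image c := fun h => by
    obtain ⟨w, hw, h⟩ := mem_image.1 h
    exact hB v hv w (hWB w hw) (hadj w hw).2 h.symm
  have hinj : Set.InjOn c W := fun x hx y hy h => by
    by_contra hne
    exact hB x (hWB x hx) y (hWB y hy) (hW.isClique hx hy hne) h
  have hsub : insert (c u) (insert (c v) (W.image c)) ⊆ range (k + 1) := by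
    intro i hi
    simp only [mem_insert, mem_image] at hi
    rcases hi with rfl | rfl | ⟨w, -, rfl⟩ <;> exact mem_range.2 (hc _)
  have := card_le_card hsub
  rw [card_insert_of_notMem (by simp only [mem_insert, huv, huW, or_self, not_false_eq_true]),
    card_insert_of_notMem hvW, card_image_of_injOn hinj, hW.card_eq, card_range] at this
  omega

/-- In a coloured saturated graph, removing the set `B` of vertices incident to the monochromatic
edges, the set `L` of vertices with many non-neighbours of a different colour, and few further
vertices, leaves a complete multipartite graph. -/
lemma exists_isCompleteMultipartiteOn {V : Type} [Fintype V] [DecidableEq V] {G : SimpleGraph V}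
    {k : ℕ} (hG : Saturated (k + 3) G) {c : V → ℕ} (hc : ∀ x, c x < k + 2) {B L : Finset V}
    (hB : ∀ x ∉ B, ∀ y ∉ B, G.Adj x y → c x ≠ c y) {D : ℕ}
    (hL : ∀ x ∉ L, #{y | c x ≠ c y ∧ ¬ G.Adj x y} ≤ D) :
    ∃ S : Finset V, IsCompleteMultipartiteOn G (k + 2) S ∧
      Fintype.card V ≤ #S + (#B + #L + (k + 2) * #B * (2 * (#B + D)) ^ (k + 1)) := by
  set Z : Finset V :=
    {v | v ∉ B ∪ L ∧ ∃ u, u ∉ B ∪ L ∧ c u ≠ c v ∧ ¬ G.Adj u v}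
  have hwit : ∀ v, ∃ u, ∃ W : Finset V, v ∈ Z → u ∉ B ∪ L ∧ c u ≠ c v ∧
      G.IsNClique (k + 1) W ∧ ∀ w ∈ W, G.Adj u w ∧ G.Adj v w := by
    intro v
    by_cases hv : v ∈ Z
    · obtain ⟨-, u, hu, hcol, hadj⟩ := (mem_filter.1 hv).2
      obtain ⟨W, hW⟩ := hG.exists_common_clique (fun h => hcol (congrArg c h)) hadj
      exact ⟨u, W, fun _ => ⟨hu, hcol, hW⟩⟩
    · exact ⟨v, ∅, fun h => absurd h hv⟩
  choose u W huW using hwit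
  have hZB : ∀ v ∈ Z, v ∉ B := fun v hv h =>
    (mem_filter.1 hv).2.1 (mem_union_left _ h)
  have huB : ∀ v ∈ Z, u v ∉ B := fun v hv h => (huW v hv).1 (mem_union_left _ h)
  have huL : ∀ v ∈ Z, u v ∉ L := fun v hv h => (huW v hv).1 (mem_union_right _ h)
  have hfiber : ∀ p ∈ range (k + 2) ×ˢ B,
      #{v ∈ Z | c (u v) = p.1 ∧ p.2 ∈ W v} ≤ (2 * (#B + D)) ^ (k + 1) := by
    rintro ⟨i, b⟩ -
    set F : Finset V := {v ∈ Z | c (u v) = i ∧ b ∈ W v}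
    have hFZ : ∀ v ∈ F, v ∈ Z := fun v hv => (mem_filter.1 hv).1
    refine card_le_of_branching (W := W)
      (Q := fun l => B ∪ ({y | c (u l) ≠ c y ∧ ¬ G.Adj (u l) y} : Finset V)) k F {b} ?_ ?_ ?_ ?_
    · exact fun l hl => singleton_subset_iff.2 (mem_filter.1 hl).2.2
    · intro l hl
      rw [(huW l (hFZ l hl)).2.2.1.card_eq, card_singleton, add_comm]
    · intro l hl
      exact (card_union_le _ _).trans (by gcongr; exact hL _ (huL l (hFZ l hl)))
    · intro a ha l hl
      obtain ⟨-, -, -, haW⟩ := huW a (hFZ a ha)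
      obtain ⟨-, hlcol, hlclique, hlW⟩ := huW l (hFZ l hl)
      have hcol : c (u a) = c (u l) :=
        (mem_filter.1 ha).2.1.trans (mem_filter.1 hl).2.1.symm
      obtain ⟨x, hx, hxa⟩ : ∃ x ∈ insert l (W l), ¬ G.Adj (u a) x := by
        by_contra! hcon
        exact hG.1 _ ((hlclique.insert fun w hw => (hlW w hw).2).insert hcon)
      refine ⟨x, ?_, mem_insert.1 hx, fun h => hxa (haW x h).1⟩
      simp only [mem_union, mem_filter, mem_univ, true_and]
      by_cases hxB : x ∈ B
      · exact Or.inl hxB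
      refine Or.inr ⟨?_, hxa⟩
      rw [hcol]
      rcases mem_insert.1 hx with rfl | hx
      · exact hlcol
      · exact hB _ (huB l (hFZ l hl)) x hxB (hlW x hx).1
  have hZcard : #Z ≤ (k + 2) * #B * (2 * (#B + D)) ^ (k + 1) := by
    have hcover : Z ⊆ (range (k + 2) ×ˢ B).biUnion
        fun p => {v ∈ Z | c (u v) = p.1 ∧ p.2 ∈ W v} := by
      intro v hv
      obtain ⟨-, hcol, hclique, hadj⟩ := huW v hv
      obtain ⟨b, hb, hbW⟩ :=
        exists_mem_of_common_clique hc hB (huB v hv) (hZB v hv) hcol hclique hadj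
      exact mem_biUnion.2 ⟨(c (u v), b), mem_product.2 ⟨mem_range.2 (hc _), hb⟩,
        mem_filter.2 ⟨hv, rfl, hbW⟩⟩
    refine (card_le_card hcover).trans ((card_biUnion_le_card_mul _ _ _ hfiber).trans ?_)
    rw [card_product, card_range]
  refine ⟨(B ∪ L ∪ Z)ᶜ, isCompleteMultipartiteOn_of_coloring hc ?_, ?_⟩
  · intro v hv w hw
    simp only [mem_compl, mem_union, not_or] at hv hw
    refine ⟨hB v hv.1.1 w hw.1.1, fun hcol => ?_⟩
    by_contra hadj
    refine hw.2 (mem_filter.2 ⟨mem_univ _, ?_, v, ?_, hcol, hadj⟩)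
    · simp [hw.1]
    · simp [hv.1]
  · rw [← card_compl_add_card (B ∪ L ∪ Z)]
    have h1 := card_union_le (B ∪ L) Z
    have h2 := card_union_le B L
    omega

/-- Markov's inequality for a finite sum of natural numbers. -/
lemma card_lt_mul_le_sum {V : Type} [Fintype V] (f : V → ℕ) (δ : ℝ) :
    #{x | δ < f x} * δ ≤ ((∑ x, f x : ℕ) : ℝ) := by
  have h1 : #{x | δ < f x} • δ ≤ ∑ x with δ < f x, (f x : ℝ) :=
    card_nsmul_le_sum _ _ _ fun x hx => (mem_filter.1 hx).2.le
  have h2 : ∑ x with δ < f x, (f x : ℝ) ≤ ∑ x, (f x : ℝ) :=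
    sum_le_sum_of_subset_of_nonneg (filter_subset _ _) fun _ _ _ => Nat.cast_nonneg _
  rw [nsmul_eq_mul] at h1
  push_cast
  exact h1.trans h2

/-- The arithmetic bounding the number of removed vertices. -/
lemma removed_mul_le {k : ℕ} {R n m y b l d : ℝ} (hb0 : 0 ≤ b) (hd0 : 0 ≤ d) (hR2 : 2 ≤ R)
    (hn0 : 0 < n) (hm0 : 0 ≤ m) (hy1 : 1 ≤ y) (hyn : y ≤ n) (hy : y ^ (k + 2) = n)
    (hm64 : 64 * R ^ 3 * m ≤ n * y) (hdy : d ≤ y) (hbn : b * n ≤ 16 * R ^ 2 * m)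
    (hLy : l * y ≤ 4 * m) :
    (b + l + R * b * (2 * (b + d)) ^ (k + 1)) * y ≤ 64 * R ^ 3 * 4 ^ (k + 2) * m := by
  have hy0 : 0 < y := by linarith
  have h4 : (1 : ℝ) ≤ 4 ^ (k + 1) := one_le_pow₀ (by norm_num)
  have h4' : (4 : ℝ) ^ (k + 2) = 4 * 4 ^ (k + 1) := by ring
  have hR3 : 1 ≤ R ^ 3 := one_le_pow₀ (by linarith)
  have hb_le : b ≤ y := by
    by_contra! hcon
    have h1 : n * y < b * n := by nlinarith
    have h2 : 16 * R ^ 2 * m ≤ 64 * R ^ 3 * m := by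
      gcongr
      · norm_num
      · linarith
      · norm_num
    linarith
  have hpow : (2 * (b + d)) ^ (k + 1) * y ≤ 4 ^ (k + 1) * n := by
    have h1 : (2 * (b + d)) ^ (k + 1) ≤ (4 * y) ^ (k + 1) := by
      apply pow_le_pow_left₀ (by positivity)
      linarith
    calc (2 * (b + d)) ^ (k + 1) * y ≤ (4 * y) ^ (k + 1) * y := by gcongr
      _ = 4 ^ (k + 1) * n := by rw [← hy]; ring
  have hterm : R * b * (2 * (b + d)) ^ (k + 1) * y ≤ 16 * R ^ 3 * 4 ^ (k + 1) * m := by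
    calc R * b * (2 * (b + d)) ^ (k + 1) * y
        = R * b * ((2 * (b + d)) ^ (k + 1) * y) := by ring
      _ ≤ R * b * (4 ^ (k + 1) * n) := by gcongr
      _ = R * 4 ^ (k + 1) * (b * n) := by ring
      _ ≤ R * 4 ^ (k + 1) * (16 * R ^ 2 * m) := by gcongr
      _ = 16 * R ^ 3 * 4 ^ (k + 1) * m := by ring
  have hby : b * y ≤ 16 * R ^ 2 * m := le_trans (by gcongr) hbn
  have hfin : 16 * R ^ 2 * m + 4 * m + 16 * R ^ 3 * 4 ^ (k + 1) * m ≤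
      64 * R ^ 3 * 4 ^ (k + 2) * m := by
    have h1 : R ^ 2 ≤ R ^ 3 := pow_le_pow_right₀ (by linarith) (by norm_num)
    have h2 : R ^ 3 ≤ R ^ 3 * 4 ^ (k + 1) := le_mul_of_one_le_right (by linarith) h4
    have h3 : 16 * R ^ 2 + 4 + 16 * R ^ 3 * 4 ^ (k + 1) ≤ 64 * R ^ 3 * (4 * 4 ^ (k + 1)) := by
      linarith
    rw [← add_mul, ← add_mul, h4']
    gcongr
  calc (b + l + R * b * (2 * (b + d)) ^ (k + 1)) * y
      = b * y + l * y + R * b * (2 * (b + d)) ^ (k + 1) * y := by ring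
    _ ≤ 64 * R ^ 3 * 4 ^ (k + 2) * m := by linarith

/-- The quantitative form of the stability theorem, in terms of `y = n^{1/r}`. -/
lemma exists_isCompleteMultipartiteOn_of_le_card_edges {V : Type} [Fintype V] [DecidableEq V]
    {G : SimpleGraph V} {k : ℕ} (hG : Saturated (k + 3) G)
    (hn : 900 * (k + 2) ^ 6 ≤ Fintype.card V) {m y : ℝ} (hm0 : 0 ≤ m)
    (hm : (turanEdges (k + 2) (Fintype.card V) : ℝ) - m ≤ #G.edgeFinset) (hy1 : 1 ≤ y)
    (hy : y ^ (k + 2) = Fintype.card V)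
    (hmy : 64 * (k + 2 : ℝ) ^ 3 * 4 ^ (k + 2) * m < Fintype.card V * y) :
    ∃ S : Finset V, IsCompleteMultipartiteOn G (k + 2) S ∧
      (Fintype.card V - #S) * y ≤ 64 * (k + 2 : ℝ) ^ 3 * 4 ^ (k + 2) * m := by
  obtain ⟨c, hc, hmiss, hcross⟩ := exists_coloring_of_le_card_edges G hG.1 hm
  have hnR : (900 * (k + 2) ^ 6 : ℝ) ≤ Fintype.card V := by exact_mod_cast hn
  have hyn : y ≤ Fintype.card V := by
    rw [← hy]
    exact le_self_pow₀ hy1 (by omega)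
  set n : ℝ := (Fintype.card V : ℝ)
  set R : ℝ := k + 2 with hR
  have hR2 : 2 ≤ R := by simp [hR]
  have hn0 : 0 < n := by linarith
  have h4 : (1 : ℝ) ≤ 4 ^ (k + 1) := one_le_pow₀ (by norm_num)
  have h4' : (4 : ℝ) ^ (k + 2) = 4 * 4 ^ (k + 1) := by ring
  have hR3 : 1 ≤ R ^ 3 := one_le_pow₀ (by linarith)
  have hm64 : 64 * R ^ 3 * m < n * y := by
    refine lt_of_le_of_lt ?_ hmy
    have : 64 * R ^ 3 * m * 1 ≤ 64 * R ^ 3 * m * 4 ^ (k + 2) := by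
      gcongr
      rw [h4']; linarith
    linarith
  have hmn : 64 * R ^ 3 * m < n * n := hm64.trans_le (by gcongr)
  set f : V → ℕ := fun x => #{y | c x ≠ c y ∧ ¬ G.Adj x y} with hf
  set δ : ℝ := n / (4 * R ^ 2) with hδ
  set B : Finset V := {x | δ < f x} with hB
  set D : ℕ := ⌊y⌋₊
  set L : Finset V := {x | y < f x} with hL
  have hBn : #B * n ≤ 16 * R ^ 2 * m := by
    have h1 := (card_lt_mul_le_sum f δ).trans hmiss
    rw [hδ, mul_div_assoc', div_le_iff₀ (by positivity)] at h1
    linarith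
  have hLy : #L * y ≤ 4 * m := (card_lt_mul_le_sum f y).trans hmiss
  have hsmall : 3 * ((k + 2 : ℕ) : ℝ) + 2 * m ≤ (n / (2 * ((k + 2 : ℕ) : ℝ))) ^ 2 := by
    push_cast
    rw [← hR, div_pow, le_div_iff₀ (by positivity)]
    have h1 : 12 * R ^ 3 ≤ n := by
      have : R ^ 3 ≤ R ^ 6 := pow_le_pow_right₀ (by linarith) (by norm_num)
      linarith
    have h2 : 24 * R ^ 3 ≤ n * n := by nlinarith
    have h3 : R ^ 2 * m ≤ R ^ 3 * m := by
      gcongr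
      · linarith
      · norm_num
    nlinarith
  have hinner : ∀ x ∉ B, ∀ z ∉ B, G.Adj x z → c x ≠ c z := by
    intro x hx z hz
    refine color_ne_of_adj hG.1 hc (B := B) (δ := δ) ?_ ?_ hx hz
    · intro w hw
      simpa [hB, hf] using hw
    · intro i hi
      have h1 := div_two_mul_le_card_color (by omega) hc hcross hsmall hi
      push_cast at h1 ⊢
      rw [← hR] at h1 ⊢
      refine lt_of_lt_of_le ?_ h1
      have h2 : (#B : ℝ) < n / (4 * R) := by
        rw [lt_div_iff₀ (by positivity)]
        by_contra! hcon
        have h3 : n * n ≤ #B * (4 * R) * n := by gcongr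
        nlinarith
      have h3 : R * δ = n / (4 * R) := by
        rw [hδ]; field_simp
      have h4 : n / (2 * R) = n / (4 * R) + n / (4 * R) := by field_simp; norm_num
      linarith
  have hLD : ∀ x ∉ L, f x ≤ D := by
    intro x hx
    refine Nat.le_floor ?_
    simpa [hL] using hx
  obtain ⟨S, hS, hcard⟩ := exists_isCompleteMultipartiteOn hG hc hinner hLD
  refine ⟨S, hS, ?_⟩
  have hcardR : n ≤ #S + (#B + #L + R * #B * (2 * (#B + D)) ^ (k + 1)) := by
    have := (Nat.cast_le (α := ℝ)).2 hcard
    push_cast at this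
    exact this
  have hbound := removed_mul_le (Nat.cast_nonneg #B) (Nat.cast_nonneg D) (by linarith) hn0 hm0
    hy1 hyn hy hm64.le (Nat.floor_le (by linarith)) hBn hLy
  calc (n - #S) * y ≤ (#B + #L + R * #B * (2 * (#B + D)) ^ (k + 1)) * y := by
        gcongr
        linarith
    _ ≤ 64 * R ^ 3 * 4 ^ (k + 2) * m := hbound

/-- Theorem 2, main theorem. Let `r ≥ 2` and `n ≥ 900r⁶`. Every
`(r+1)`-saturated graph `G` on `n` vertices with `e(G) ≥ t_r(n) − m` contains a complete
`r`-partite induced subgraph on at least `(1 − C_r m n^{-(r+1)/r})n` vertices. -/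
theorem main_theorem (r : ℕ) (hr : 2 ≤ r) :
    ∃ C : ℝ, 0 < C ∧
      ∀ (n : ℕ), 900 * r ^ 6 ≤ n →
        ∀ (V : Type) [Fintype V] [DecidableEq V],
          ∀ (G : SimpleGraph V) (m : ℝ), 0 ≤ m →
            Fintype.card V = n → Saturated (r + 1) G →
            (turanEdges r n : ℝ) - m ≤ (G.edgeFinset.card : ℝ) →
            ∃ S : Finset V, IsCompleteMultipartiteOn G r S ∧
              (1 - C * m * (n : ℝ) ^ (-((r : ℝ) + 1) / (r : ℝ))) * n ≤ (S.card : ℝ) := by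
  obtain ⟨k, rfl⟩ : ∃ k, r = k + 2 := ⟨r - 2, by omega⟩
  have hC : (0 : ℝ) < 64 * (k + 2 : ℝ) ^ 3 * 4 ^ (k + 2) := by positivity
  refine ⟨64 * (k + 2 : ℝ) ^ 3 * 4 ^ (k + 2), hC, ?_⟩
  intro n hn V _ _ G m hm0 hcard hG hm
  subst hcard
  have hn1 : (1 : ℝ) ≤ Fintype.card V := by
    have : 1 ≤ 900 * (k + 2) ^ 6 := Nat.one_le_iff_ne_zero.2 (by positivity)
    exact_mod_cast this.trans hn
  have hn0 : (0 : ℝ) < Fintype.card V := by linarith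
  set y : ℝ := (Fintype.card V : ℝ) ^ ((1 : ℝ) / (k + 2)) with hy
  have hy1 : 1 ≤ y := Real.one_le_rpow hn1 (by positivity)
  have hy0 : 0 < y := by linarith
  have hyk : y ^ (k + 2) = Fintype.card V := by
    rw [hy, ← Real.rpow_natCast, ← Real.rpow_mul hn0.le]
    push_cast
    rw [one_div_mul_cancel (by positivity), Real.rpow_one]
  have hexp : (Fintype.card V : ℝ) ^ (-(((k + 2 : ℕ) : ℝ) + 1) / ((k + 2 : ℕ) : ℝ)) =
      (Fintype.card V * y)⁻¹ := by
    have : -(((k + 2 : ℕ) : ℝ) + 1) / ((k + 2 : ℕ) : ℝ) = -(1 + 1 / (k + 2)) := by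
      push_cast
      field_simp
    rw [this, Real.rpow_neg hn0.le, Real.rpow_add hn0, Real.rpow_one]
  rw [hexp]
  rcases lt_or_ge (64 * (k + 2 : ℝ) ^ 3 * 4 ^ (k + 2) * m) (Fintype.card V * y) with hmy | hmy
  · obtain ⟨S, hS, hle⟩ :=
      exists_isCompleteMultipartiteOn_of_le_card_edges hG hn hm0 (by convert hm) hy1 hyk hmy
    refine ⟨S, hS, ?_⟩
    rw [← le_div_iff₀ hy0] at hle
    have : (1 - 64 * (k + 2 : ℝ) ^ 3 * 4 ^ (k + 2) * m * (Fintype.card V * y)⁻¹) *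
        Fintype.card V =
        Fintype.card V - 64 * (k + 2 : ℝ) ^ 3 * 4 ^ (k + 2) * m / y := by
      field_simp
    linarith
  · refine ⟨∅, isCompleteMultipartiteOn_of_coloring (c := fun _ => 0) (by simp) (by simp), ?_⟩
    have : 1 ≤ 64 * (k + 2 : ℝ) ^ 3 * 4 ^ (k + 2) * m * (Fintype.card V * y)⁻¹ := by
      rw [← div_eq_mul_inv, one_le_div (by positivity)]
      exact hmy
    rw [card_empty, Nat.cast_zero]
    exact mul_nonpos_of_nonpos_of_nonneg (by linarith) hn0.le
end
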